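/- Let R = ℤ[δ] with δ an indeterminate and let A_i = A_i(R; δ) be the Temperley–Lieb algebra. Then for each i ≥ 1 the set 𝒜_i = {d_s* c_l d_t : l ∈ Â_i, s,t ∈ Â_i^l} is an R-basis of A_i, and (A_i, *, Â_i, ⊵, 𝒜_i) is a cell datum for A_i. -/

import Mathlib

noncomputable section

/-! ### The Temperley–Lieb algebra, by generators and relations -/

/-- Index set for the generators `e_1, …, e_{n-1}`. -/
abbrev TLIdx (n : ℕ) : Type := {i : ℕ // 1 ≤ i ∧ i < n}

/-- The defining relations of the Temperley–Lieb algebra `A_n(δ)`: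
`e_i e_{i±1} e_i = e_i`, `e_i² = δ e_i`, and `e_i e_j = e_j e_i` for `|i-j| ≥ 2`. -/
inductive TLRel (R : Type) [CommRing R] (δ : R) (n : ℕ) :
    FreeAlgebra R (TLIdx n) → FreeAlgebra R (TLIdx n) → Prop
  | idem (i : TLIdx n) :
      TLRel R δ n (FreeAlgebra.ι R i * FreeAlgebra.ι R i)
        (algebraMap R (FreeAlgebra R (TLIdx n)) δ * FreeAlgebra.ι R i)
  | hopUp (i j : TLIdx n) (h : j.1 = i.1 + 1) :
      TLRel R δ n (FreeAlgebra.ι R i * FreeAlgebra.ι R j * FreeAlgebra.ι R i)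
        (FreeAlgebra.ι R i)
  | hopDown (i j : TLIdx n) (h : j.1 = i.1 + 1) :
      TLRel R δ n (FreeAlgebra.ι R j * FreeAlgebra.ι R i * FreeAlgebra.ι R j)
        (FreeAlgebra.ι R j)
  | comm (i j : TLIdx n) (h : i.1 + 1 < j.1) :
      TLRel R δ n (FreeAlgebra.ι R i * FreeAlgebra.ι R j)
        (FreeAlgebra.ι R j * FreeAlgebra.ι R i)

/-- The Temperley–Lieb algebra `A_n(R; δ)`. -/
abbrev TL (R : Type) [CommRing R] (δ : R) (n : ℕ) : Type := RingQuot (TLRel R δ n)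

/-- The generator `e_i` (equal to `1` for out-of-range `i`). -/
def TLe (R : Type) [CommRing R] (δ : R) (n : ℕ) (i : ℕ) : TL R δ n :=
  if h : 1 ≤ i ∧ i < n then
    RingQuot.mkAlgHom R (TLRel R δ n) (FreeAlgebra.ι R (⟨i, h⟩ : TLIdx n))
  else 1

/-- The element `e^{(l)}_{k-1} = e_{j+1} e_{j+3} ⋯ e_{k-1}` with `l = (k-j)/2`
(an ordered product of `l` factors). -/
def eStair (R : Type) [CommRing R] (δ : R) (n : ℕ) (k j : ℕ) : TL R δ n :=
  ((List.range ((k - j) / 2)).map (fun t => TLe R δ n (j + 1 + 2 * t))).prod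

/-- The poset `Â_i = {j : 0 ≤ j ≤ i, i - j even}` for the Temperley–Lieb algebra
(ordered by `m ⊵ l` iff `l ≥ m` as integers; we only need the strict relation
`m ▷ l` iff `m < l` as integers). -/
abbrev TLLam (i : ℕ) : Type := {j : ℕ // j ≤ i ∧ (i - j) % 2 = 0}

/-- Paths on the Temperley–Lieb branching diagram from `0` at level `0` to `l` at
level `i` (each step changes the label by `±1`). -/
def TLPath (i : ℕ) (l : ℕ) : Type :=
  {pp : Fin (i + 1) → ℕ //
    pp 0 = 0 ∧ pp (Fin.last i) = l ∧
    ∀ k : Fin i, pp k.succ = pp k.castSucc + 1 ∨ pp k.castSucc = pp k.succ + 1}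

/-- The path element `d_t = d^{(i)}_{l_{i-1}→l_i} ⋯ d^{(1)}_{0→1}`, where
`d^{(k+1)}_{j→·} = e^{((k-j)/2)}_{k-1}`. -/
def dTLPath (R : Type) [CommRing R] (δ : R) (i : ℕ) {l : ℕ} (t : TLPath i l) :
    TL R δ i :=
  ((List.ofFn (fun k : Fin i => eStair R δ i k.val (t.1 k.castSucc))).reverse).prod

namespace TemperleyLieb

section Abstract

variable {R A : Type} [CommRing R] [Ring A] [Algebra R A]

/-- The Temperley–Lieb relations for the elements `e 1, …, e (n - 1)`. -/
structure Family (δ : R) (n : ℕ) (e : ℕ → A) : Prop where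
  sq : ∀ i, 1 ≤ i → i < n → e i * e i = δ • e i
  up : ∀ i, 1 ≤ i → i + 1 < n → e i * e (i + 1) * e i = e i
  down : ∀ i, 1 ≤ i → i + 1 < n → e (i + 1) * e i * e (i + 1) = e (i + 1)
  comm : ∀ i j, 1 ≤ i → i + 1 < j → j < n → e i * e j = e j * e i

/-- The product `e a * e (a + 2) * ⋯` with `m` factors. -/
def stair (e : ℕ → A) (a m : ℕ) : A :=
  ((List.range m).map (fun t => e (a + 2 * t))).prod

@[simp] lemma stair_zero (e : ℕ → A) (a : ℕ) : stair e a 0 = 1 := by simp [stair]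

lemma stair_succ (e : ℕ → A) (a m : ℕ) :
    stair e a (m + 1) = stair e a m * e (a + 2 * m) := by
  simp [stair, List.range_succ]

lemma stair_succ_left (e : ℕ → A) (a m : ℕ) :
    stair e a (m + 1) = e a * stair e (a + 2) m := by
  simp only [stair, List.range_succ_eq_map, List.map_cons, List.prod_cons, List.map_map]
  congr 3
  funext t
  simp only [Function.comp]
  congr 1
  omega

/-- The product attached to a vertex `j` at level `k` of the branching diagram. -/
def vertex (e : ℕ → A) (k j : ℕ) : A := stair e (j + 1) ((k - j) / 2)

/-- The product of the vertices of the path `p` at the levels `k - 1, …, 0`. -/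
def pathProd (e : ℕ → A) (p : ℕ → ℕ) : ℕ → A
  | 0 => 1
  | k + 1 => vertex e k (p k) * pathProd e p k

lemma pathProd_congr (e : ℕ → A) {p q : ℕ → ℕ} {k : ℕ} (h : ∀ j < k, p j = q j) :
    pathProd e p k = pathProd e q k := by
  induction k with
  | zero => rfl
  | succ k ih =>
    rw [pathProd, pathProd, h k (by omega), ih fun j hj => h j (by omega)]

/-- `p` restricts to a path on the branching diagram from `0` to `l` at level `k`. -/
def IsPath (p : ℕ → ℕ) (k l : ℕ) : Prop :=
  p 0 = 0 ∧ p k = l ∧ ∀ j < k, p (j + 1) = p j + 1 ∨ p j = p (j + 1) + 1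

lemma IsPath.le_and_parity {p : ℕ → ℕ} {k l : ℕ} (h : IsPath p k l) :
    l ≤ k ∧ (k - l) % 2 = 0 := by
  obtain ⟨h0, rfl, hs⟩ := h
  induction k with
  | zero => simp [h0]
  | succ k ih =>
    have := ih fun j hj => hs j (by omega)
    have := hs k (by omega)
    omega

/-- The subalgebra generated by `e 1, …, e (k - 1)`. -/
def level (R : Type) [CommRing R] [Algebra R A] (e : ℕ → A) (k : ℕ) : Subalgebra R A :=
  Algebra.adjoin R {x | ∃ j, 1 ≤ j ∧ j < k ∧ x = e j}

lemma level_mono (e : ℕ → A) {k k' : ℕ} (h : k ≤ k') : level R e k ≤ level R e k' :=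
  Algebra.adjoin_mono fun _ ⟨j, h1, h2, h3⟩ => ⟨j, h1, by omega, h3⟩

lemma mem_level (e : ℕ → A) {k j : ℕ} (h1 : 1 ≤ j) (h2 : j < k) : e j ∈ level R e k :=
  Algebra.subset_adjoin ⟨j, h1, h2, rfl⟩

lemma stair_mem_level (e : ℕ → A) {a m k : ℕ} (h1 : 1 ≤ a) (h2 : a + 2 * m ≤ k + 1) :
    stair e a m ∈ level R e k := by
  induction m with
  | zero => simp
  | succ m ih =>
    rw [stair_succ]
    exact mul_mem (ih (by omega)) (mem_level e (by omega) (by omega))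

lemma vertex_mem_level (e : ℕ → A) {k j k' : ℕ} (h : k ≤ k') :
    vertex e k j ∈ level R e k' := by
  by_cases hj : j ≤ k
  · exact stair_mem_level e (by omega) (by omega)
  · rw [vertex, show (k - j) / 2 = 0 by omega, stair_zero]
    exact one_mem _

namespace Family

variable {δ : R} {n : ℕ} {e : ℕ → A}

lemma commute (h : Family δ n e) {i j : ℕ} (hi : 1 ≤ i) (hij : i + 1 < j) (hj : j < n) :
    Commute (e i) (e j) := h.comm i j hi hij hj

lemma commute_stair (h : Family δ n e) {i a m : ℕ} (hi : 1 ≤ i) (ha : i + 1 < a)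
    (hm : a + 2 * m ≤ n + 1) : Commute (e i) (stair e a m) := by
  induction m with
  | zero => simp
  | succ m ih =>
    rw [stair_succ]
    exact (ih (by omega)).mul_right (h.commute hi (by omega) (by omega))

lemma commute_level (h : Family δ n e) {j k : ℕ} (hk : k < j) (hj : j < n) {x : A}
    (hx : x ∈ level R e k) : Commute (e j) x := by
  induction hx using Algebra.adjoin_induction with
  | mem x hx =>
    obtain ⟨i, h1, h2, rfl⟩ := hx
    exact (h.commute h1 (by omega) hj).symm
  | algebraMap r => exact (Algebra.commutes r (e j)).symm
  | add x y _ _ hx hy => exact hx.add_right hy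
  | mul x y _ _ hx hy => exact hx.mul_right hy

lemma stair_zigzag (h : Family δ n e) {a m : ℕ} (ha : 1 ≤ a) (hm : a + 2 * m ≤ n) :
    stair e a m * stair e (a + 1) m * stair e a m = stair e a m := by
  induction m generalizing a with
  | zero => simp
  | succ m ih =>
    have c1 : Commute (e a) (stair e (a + 2) m) := h.commute_stair ha (by omega) (by omega)
    have c2 : Commute (e a) (stair e (a + 3) m) := h.commute_stair ha (by omega) (by omega)
    have ih' := ih (a := a + 2) (by omega) (by omega)
    simp only [stair_succ_left, show a + 1 + 2 = a + 3 by omega] at ih' ⊢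
    calc e a * stair e (a + 2) m * (e (a + 1) * stair e (a + 3) m) * (e a * stair e (a + 2) m)
        = stair e (a + 2) m * (e a * e (a + 1) * (stair e (a + 3) m * e a)) *
          stair e (a + 2) m := by nth_rewrite 1 [c1.eq]; noncomm_ring
      _ = stair e (a + 2) m * e a * stair e (a + 3) m * stair e (a + 2) m := by
          rw [← c2.eq, ← mul_assoc (e a * e (a + 1)), h.up a ha (by omega)]; noncomm_ring
      _ = e a * (stair e (a + 2) m * stair e (a + 3) m * stair e (a + 2) m) := by
          rw [← c1.eq]; noncomm_ring
      _ = _ := by rw [ih']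

lemma stair_zigzag_succ (h : Family δ n e) {a m : ℕ} (ha : 1 ≤ a) (hm : a + 2 * m < n) :
    stair e a (m + 1) * stair e (a + 1) m * stair e a m = stair e a (m + 1) := by
  induction m generalizing a with
  | zero => simp
  | succ m ih =>
    have c1 : Commute (e a) (stair e (a + 2) (m + 1)) :=
      h.commute_stair ha (by omega) (by omega)
    have c2 : Commute (e a) (stair e (a + 3) m) := h.commute_stair ha (by omega) (by omega)
    have ih' := ih (a := a + 2) (by omega) (by omega)
    rw [stair_succ_left e a (m + 1), stair_succ_left e a m, stair_succ_left e (a + 1) m]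
    simp only [show a + 1 + 2 = a + 3 by omega] at ih' ⊢
    calc e a * stair e (a + 2) (m + 1) * (e (a + 1) * stair e (a + 3) m) *
          (e a * stair e (a + 2) m)
        = stair e (a + 2) (m + 1) * (e a * e (a + 1) * (stair e (a + 3) m * e a)) *
          stair e (a + 2) m := by rw [c1.eq]; noncomm_ring
      _ = stair e (a + 2) (m + 1) * e a * stair e (a + 3) m * stair e (a + 2) m := by
          rw [← c2.eq, ← mul_assoc (e a * e (a + 1)), h.up a ha (by omega)]; noncomm_ring
      _ = e a * (stair e (a + 2) (m + 1) * stair e (a + 3) m * stair e (a + 2) m) := by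
          rw [← c1.eq]; noncomm_ring
      _ = _ := by rw [ih']

/-- Elements of the algebra one level up are sums of `a` and `a * e k * b`. -/
lemma level_succ_induction {k : ℕ} (hk : 1 ≤ k)
    (hcond : ∀ x ∈ level R e k, ∃ y ∈ level R e (k - 1), e k * x * e k = y * e k)
    {P : A → Prop} (base : ∀ a ∈ level R e k, P a)
    (mid : ∀ a ∈ level R e k, ∀ b ∈ level R e k, P (a * e k * b))
    (add : ∀ x y, P x → P y → P (x + y)) {x : A} (hx : x ∈ level R e (k + 1)) : P x := by
  let T : Submodule R A := Submodule.span R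
    ({z | z ∈ level R e k} ∪ {z | ∃ a ∈ level R e k, ∃ b ∈ level R e k, z = a * e k * b})
  have hT : ∀ z ∈ T, P z := by
    intro z hz
    induction hz using Submodule.span_induction with
    | mem z hz =>
      rcases hz with hz | ⟨a, ha, b, hb, rfl⟩
      · exact base z hz
      · exact mid a ha b hb
    | zero => exact base 0 (zero_mem _)
    | add x y _ _ hx hy => exact add x y hx hy
    | smul r z hz ih =>
      clear ih
      induction hz using Submodule.span_induction generalizing r with
      | mem z hz =>
        rcases hz with hz | ⟨a, ha, b, hb, rfl⟩
        · exact base _ (Subalgebra.smul_mem _ hz r)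
        · rw [← smul_mul_assoc, ← smul_mul_assoc]
          exact mid _ (Subalgebra.smul_mem _ ha r) b hb
      | zero => simpa using base 0 (zero_mem _)
      | add x y _ _ hx hy => rw [smul_add]; exact add _ _ (hx r) (hy r)
      | smul s z _ ih => rw [smul_smul]; exact ih _
  have key : ∀ x ∈ level R e (k + 1), ∀ z ∈ T, z * x ∈ T := by
    intro x hx
    induction hx using Algebra.adjoin_induction with
    | mem x hx =>
      obtain ⟨j, h1, h2, rfl⟩ := hx
      intro z hz
      induction hz using Submodule.span_induction with
      | mem z hz =>
        rcases Nat.lt_succ_iff_lt_or_eq.mp h2 with h2 | rfl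
        · have hj := mem_level (R := R) e h1 h2
          rcases hz with hz | ⟨a, ha, b, hb, rfl⟩
          · exact Submodule.subset_span (Or.inl (mul_mem hz hj))
          · exact Submodule.subset_span (Or.inr ⟨a, ha, _, mul_mem hb hj, by rw [mul_assoc]⟩)
        · rcases hz with hz | ⟨a, ha, b, hb, rfl⟩
          · exact Submodule.subset_span (Or.inr ⟨z, hz, 1, one_mem _, by rw [mul_one]⟩)
          · obtain ⟨y, hy, hye⟩ := hcond b hb
            refine Submodule.subset_span (Or.inr ⟨a * y,
              mul_mem ha (level_mono e (by omega) hy), 1, one_mem _, ?_⟩)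
            rw [mul_one, mul_assoc a y, ← hye]
            noncomm_ring
      | zero => simp
      | add x y _ _ hx hy => rw [add_mul]; exact add_mem hx hy
      | smul r z _ ih => rw [smul_mul_assoc]; exact Submodule.smul_mem _ r ih
    | algebraMap r =>
      intro z hz
      rw [← Algebra.commutes, ← Algebra.smul_def]
      exact Submodule.smul_mem _ r hz
    | add x y _ _ hx hy => intro z hz; rw [mul_add]; exact add_mem (hx z hz) (hy z hz)
    | mul x y _ _ hx hy => intro z hz; rw [← mul_assoc]; exact hy _ (hx z hz)
  have := key x hx 1 (Submodule.subset_span (Or.inl (one_mem (level R e k))))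
  exact hT x (by simpa using this)

/-- Compressing by `e k` maps each level to the preceding one. -/
lemma exists_compression (h : Family δ n e) {k : ℕ} (hk : 1 ≤ k) (hkn : k < n) :
    ∀ x ∈ level R e k, ∃ y ∈ level R e (k - 1), e k * x * e k = y * e k := by
  induction k, hk using Nat.le_induction with
  | base =>
    intro x hx
    have h1 : level R e 1 ≤ ⊥ := Algebra.adjoin_le (by rintro x ⟨j, h1, h2, rfl⟩; omega)
    obtain ⟨r, rfl⟩ := Algebra.mem_bot.mp (h1 hx)
    refine ⟨algebraMap R A (r * δ), algebraMap_mem _ _, ?_⟩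
    rw [← Algebra.commutes, mul_assoc, h.sq 1 le_rfl hkn, ← Algebra.smul_def, ← Algebra.smul_def,
      smul_smul]
  | succ k hk ih =>
    intro x hx
    have ih := ih (by omega)
    refine level_succ_induction
      (P := fun x => ∃ y ∈ level R e k, e (k + 1) * x * e (k + 1) = y * e (k + 1))
      hk ih ?_ ?_ ?_ hx
    · intro a ha
      refine ⟨δ • a, Subalgebra.smul_mem _ ha δ, ?_⟩
      rw [(h.commute_level (by omega) hkn ha).eq, mul_assoc, h.sq _ (by omega) hkn]
      simp
    · intro a ha b hb
      refine ⟨a * b, mul_mem ha hb, ?_⟩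
      have ca := h.commute_level (j := k + 1) (by omega) hkn ha
      have cb := h.commute_level (j := k + 1) (by omega) hkn hb
      calc e (k + 1) * (a * e k * b) * e (k + 1)
          = (e (k + 1) * a) * e k * (b * e (k + 1)) := by noncomm_ring
        _ = a * (e (k + 1) * e k * e (k + 1)) * b := by rw [ca.eq, ← cb.eq]; noncomm_ring
        _ = a * b * e (k + 1) := by rw [h.down k hk hkn, mul_assoc, cb.eq, mul_assoc]
    · rintro x y ⟨x', hx', ex⟩ ⟨y', hy', ey⟩
      exact ⟨x' + y', add_mem hx' hy', by rw [mul_add, add_mul, ex, ey, add_mul]⟩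

lemma exists_mul_eq (h : Family δ n e) {k : ℕ} (hk : 1 ≤ k) (hkn : k < n) {x : A}
    (hx : x ∈ level R e (k + 1)) : ∃ y ∈ level R e k, e k * x = e k * y := by
  have hc := h.exists_compression hk hkn
  refine level_succ_induction (P := fun x => ∃ y ∈ level R e k, e k * x = e k * y)
    hk hc ?_ ?_ ?_ hx
  · exact fun a ha => ⟨a, ha, rfl⟩
  · intro a ha b hb
    obtain ⟨y, hy, ye⟩ := hc a ha
    refine ⟨y * b, mul_mem (level_mono e (by omega) hy) hb, ?_⟩
    rw [← mul_assoc, ← mul_assoc, ye, ← mul_assoc, (h.commute_level (by omega) hkn hy).eq]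
  · rintro x y ⟨x', hx', ex⟩ ⟨y', hy', ey⟩
    exact ⟨x' + y', add_mem hx' hy', by rw [mul_add, ex, ey, mul_add]⟩

end Family

/-- The two-sided ideal of level `k` spanned by the vertices with label smaller than `l`. -/
def lower (R : Type) [CommRing R] [Algebra R A] (e : ℕ → A) (k l : ℕ) : Submodule R A :=
  Submodule.span R {x | ∃ m, m < l ∧ m ≤ k ∧ (k - m) % 2 = 0 ∧
    ∃ a ∈ level R e k, ∃ b ∈ level R e k, x = a * vertex e k m * b}

lemma mem_lower (e : ℕ → A) {k l m : ℕ} (h1 : m < l) (h2 : m ≤ k) (h3 : (k - m) % 2 = 0)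
    {a b : A} (ha : a ∈ level R e k) (hb : b ∈ level R e k) :
    a * vertex e k m * b ∈ lower R e k l :=
  Submodule.subset_span ⟨m, h1, h2, h3, a, ha, b, hb, rfl⟩

lemma mul_mul_mem_lower {e : ℕ → A} {k l : ℕ} {a b x : A} (ha : a ∈ level R e k)
    (hb : b ∈ level R e k) (hx : x ∈ lower R e k l) : a * x * b ∈ lower R e k l := by
  induction hx using Submodule.span_induction with
  | mem x hx =>
    obtain ⟨m, h1, h2, h3, c, hc, d, hd, rfl⟩ := hx
    have := mem_lower e h1 h2 h3 (mul_mem ha hc) (mul_mem hd hb)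
    simpa only [mul_assoc] using this
  | zero => simp
  | add x y _ _ hx hy => rw [mul_add, add_mul]; exact add_mem hx hy
  | smul r x _ hx =>
    rw [mul_smul_comm, smul_mul_assoc]
    exact Submodule.smul_mem _ r hx

/-- The span of the elements attached to the paths from `0` to `l` at level `k`. -/
def pathSpan (R : Type) [CommRing R] [Algebra R A] (e : ℕ → A) (k l : ℕ) : Submodule R A :=
  Submodule.span R {x | ∃ p, IsPath p k l ∧ x = vertex e k l * pathProd e p k}

lemma vertex_mul_pathSpan (e : ℕ → A) {k l l' : ℕ} (h : l = l' + 1 ∨ l' = l + 1) {x : A}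
    (hx : x ∈ pathSpan R e k l') : vertex e (k + 1) l * x ∈ pathSpan R e (k + 1) l := by
  induction hx using Submodule.span_induction with
  | mem x hx =>
    obtain ⟨p, ⟨h0, hk, hs⟩, rfl⟩ := hx
    refine Submodule.subset_span ⟨Function.update p (k + 1) l, ⟨?_, ?_, ?_⟩, ?_⟩
    · rw [Function.update_of_ne (by omega), h0]
    · rw [Function.update_self]
    · intro j hj
      rw [Function.update_of_ne (a := j) (by omega)]
      by_cases hjk : j = k
      · subst hjk
        rw [Function.update_self, hk]
        exact h
      · rw [Function.update_of_ne (by omega)]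
        exact hs j (by omega)
    · rw [pathProd, Function.update_of_ne (by omega), hk]
      congr 2
      exact pathProd_congr e fun j hj => (Function.update_of_ne (by omega) _ _).symm
  | zero => simp
  | add x y _ _ hx hy => rw [mul_add]; exact add_mem hx hy
  | smul r x _ hx =>
    rw [mul_smul_comm]
    exact Submodule.smul_mem _ r hx

namespace Family

variable {δ : R} {n : ℕ} {e : ℕ → A}

lemma vertex_zigzag (h : Family δ n e) {k m : ℕ} (hk : k < n) (hm : m ≤ k) :
    vertex e k m * vertex e (k + 1) (m + 1) * vertex e k m = vertex e k m := by
  rw [vertex, vertex, show (k + 1 - (m + 1)) / 2 = (k - m) / 2 by omega]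
  exact h.stair_zigzag (by omega) (by omega)

lemma vertex_zigzag_succ (h : Family δ n e) {k m : ℕ} (hk : k + 1 < n) (hm : m ≤ k) :
    vertex e (k + 2) m * vertex e (k + 1) (m + 1) * vertex e k m = vertex e (k + 2) m := by
  rw [vertex, vertex, vertex, show (k + 1 - (m + 1)) / 2 = (k - m) / 2 by omega,
    show (k + 2 - m) / 2 = (k - m) / 2 + 1 by omega]
  exact h.stair_zigzag_succ (by omega) (by omega)

lemma vertex_add_two (e : ℕ → A) {k m : ℕ} (hm : m ≤ k) (hp : (k - m) % 2 = 0) :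
    vertex e (k + 2) m = vertex e k m * e (k + 1) := by
  rw [vertex, vertex, show (k + 2 - m) / 2 = (k - m) / 2 + 1 by omega, stair_succ,
    show m + 1 + 2 * ((k - m) / 2) = k + 1 by omega]

lemma lower_le_succ (h : Family δ n e) {k l : ℕ} (hk : k < n) :
    lower R e k l ≤ lower R e (k + 1) (l + 1) := by
  refine Submodule.span_le.mpr ?_
  rintro _ ⟨m, h1, h2, h3, a, ha, b, hb, rfl⟩
  have hv := vertex_mem_level (R := R) e (k := k) (j := m) (k' := k + 1) (by omega)
  have := mem_lower e (k := k + 1) (l := l + 1) (m := m + 1) (by omega) (by omega) (by omega)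
    (mul_mem (level_mono e (by omega) ha) hv) (mul_mem hv (level_mono e (by omega) hb))
  rw [SetLike.mem_coe, ← h.vertex_zigzag hk h2]
  simpa only [mul_assoc] using this

lemma lower_mul_le (h : Family δ n e) {k l : ℕ} (hk : k + 1 < n) {x : A}
    (hx : x ∈ lower R e k l) : x * e (k + 1) ∈ lower R e (k + 2) l := by
  induction hx using Submodule.span_induction with
  | mem x hx =>
    obtain ⟨m, h1, h2, h3, a, ha, b, hb, rfl⟩ := hx
    have := mem_lower e (k := k + 2) h1 (by omega) (by omega)
      (level_mono e (by omega) ha) (level_mono e (by omega) hb)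
    rw [vertex_add_two e h2 h3] at this
    rw [mul_assoc, ← (h.commute_level (j := k + 1) (by omega) hk hb).eq]
    simpa only [mul_assoc] using this
  | zero => simp
  | add x y _ _ hx hy => rw [add_mul]; exact add_mem hx hy
  | smul r x _ hx =>
    rw [smul_mul_assoc]
    exact Submodule.smul_mem _ r hx

lemma generator_mem_lower (h : Family δ n e) {l j : ℕ} (hl : l ≤ n) (hj : 1 ≤ j) (hjl : j < l) :
    e j ∈ lower R e l l := by
  obtain ⟨d, rfl⟩ : ∃ d, l = j + 1 + d := ⟨l - (j + 1), by omega⟩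
  clear hjl
  induction d generalizing j with
  | zero =>
    have := mem_lower (R := R) e (k := j + 1) (l := j + 1) (m := j - 1) (by omega) (by omega)
      (by omega) (one_mem _) (one_mem _)
    rw [vertex, show (j + 1 - (j - 1)) / 2 = 0 + 1 by omega, stair_succ,
      show j - 1 + 1 + 2 * 0 = j by omega] at this
    simpa using this
  | succ d ih =>
    have := ih (j := j + 1) (by omega) (by omega)
    rw [show j + 1 + 1 + d = j + 1 + (d + 1) by omega] at this
    have hj := mem_level (R := R) e (k := j + 1 + (d + 1)) hj (by omega)
    rw [← h.up j ‹_› (by omega)]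
    exact mul_mul_mem_lower hj hj this

/-- Modulo smaller labels, level `l` consists of scalars. -/
lemma exists_scalar (h : Family δ n e) {l : ℕ} (hl : l ≤ n) {x : A} (hx : x ∈ level R e l) :
    ∃ r : R, x - algebraMap R A r ∈ lower R e l l := by
  induction hx using Algebra.adjoin_induction with
  | mem x hx =>
    obtain ⟨j, h1, h2, rfl⟩ := hx
    exact ⟨0, by simpa using h.generator_mem_lower hl h1 h2⟩
  | algebraMap r => exact ⟨r, by simp⟩
  | add x y _ _ hx hy =>
    obtain ⟨r, hr⟩ := hx
    obtain ⟨s, hs⟩ := hy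
    refine ⟨r + s, ?_⟩
    rw [map_add, add_sub_add_comm]
    exact add_mem hr hs
  | mul x y hx' _ hx hy =>
    obtain ⟨r, hr⟩ := hx
    obtain ⟨s, hs⟩ := hy
    refine ⟨r * s, ?_⟩
    have e1 := mul_mul_mem_lower hx' (one_mem _) hs
    have e2 := mul_mul_mem_lower (one_mem _) (algebraMap_mem _ s) hr
    have := add_mem e1 e2
    rw [map_mul]
    convert this using 1
    noncomm_ring

/-- Modulo smaller labels, compressing by a vertex gives multiples of that vertex. -/
lemma vertex_mul_mul_vertex (h : Family δ n e) {k l : ℕ} (hk : k ≤ n) (hl : l ≤ k)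
    (hp : (k - l) % 2 = 0) {x : A} (hx : x ∈ level R e k) :
    ∃ r : R, vertex e k l * x * vertex e k l - r • vertex e k l ∈ lower R e k l := by
  obtain ⟨m, rfl⟩ : ∃ m, k = l + 2 * m := ⟨(k - l) / 2, by omega⟩
  clear hl hp
  induction m generalizing x with
  | zero =>
    obtain ⟨r, hr⟩ := h.exists_scalar hk hx
    exact ⟨r, by simpa [vertex, Algebra.smul_def] using hr⟩
  | succ m ih =>
    set k := l + 2 * m with hkdef
    rw [show l + 2 * (m + 1) = k + 2 by omega] at hx hk ⊢
    obtain ⟨y, hy, ey⟩ := h.exists_mul_eq (k := k + 1) (by omega) (by omega) hx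
    obtain ⟨z, hz, ez⟩ := h.exists_compression (k := k + 1) (by omega) (by omega) y hy
    obtain ⟨r, hr⟩ := ih (by omega) hz
    refine ⟨r, ?_⟩
    have := h.lower_mul_le (by omega) hr
    convert this using 1
    have hc := h.commute_level (j := k + 1) (by omega) (by omega)
      (vertex_mem_level (R := R) e (k := k) (j := l) le_rfl)
    rw [vertex_add_two e (by omega) (by omega), sub_mul, smul_mul_assoc]
    congr 1
    calc vertex e k l * e (k + 1) * x * (vertex e k l * e (k + 1))
        = vertex e k l * (e (k + 1) * x) * (e (k + 1) * vertex e k l) := by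
          rw [hc.eq]; noncomm_ring
      _ = vertex e k l * (e (k + 1) * y * e (k + 1)) * vertex e k l := by
          rw [ey]; noncomm_ring
      _ = vertex e k l * z * (e (k + 1) * vertex e k l) := by rw [ez]; noncomm_ring
      _ = _ := by rw [hc.eq]; noncomm_ring

lemma vertex_self_mul_mem (h : Family δ n e) {k : ℕ} (hk : k ≤ n) {x : A}
    (hx : x ∈ level R e k) : vertex e k k * x ∈ pathSpan R e k k ⊔ lower R e k k := by
  obtain ⟨r, hr⟩ := h.exists_scalar hk hx
  have hv (j : ℕ) : vertex e j j = 1 := by simp [vertex]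
  have hp (j : ℕ) : pathProd e id j = 1 := by
    induction j with
    | zero => rfl
    | succ j ih => rw [pathProd, ih, id, hv, mul_one]
  refine Submodule.mem_sup.mpr ⟨algebraMap R A r, ?_, _, hr, by simp [hv]⟩
  rw [Algebra.algebraMap_eq_smul_one]
  refine Submodule.smul_mem _ r (Submodule.subset_span
    ⟨id, ⟨rfl, rfl, fun j _ => Or.inl rfl⟩, by rw [hv, hp, mul_one]⟩)

/-- Modulo smaller labels, the right ideal of a vertex is spanned by the paths ending there. -/
theorem vertex_mul_mem (h : Family δ n e) {k l : ℕ} (hk : k ≤ n) (hl : l ≤ k)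
    (hp : (k - l) % 2 = 0) {x : A} (hx : x ∈ level R e k) :
    vertex e k l * x ∈ pathSpan R e k l ⊔ lower R e k l := by
  induction k generalizing l x with
  | zero =>
    obtain rfl : l = 0 := by omega
    exact h.vertex_self_mul_mem hk hx
  | succ k ih =>
    obtain rfl | hlk := hl.eq_or_lt
    · exact h.vertex_self_mul_mem hk hx
    obtain ⟨k, rfl⟩ : ∃ k', k = k' + 1 := ⟨k - 1, by omega⟩
    obtain ⟨y, hy, ey⟩ := h.exists_mul_eq (k := k + 1) (by omega) (by omega) hx
    have hxy : vertex e (k + 2) l * x =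
        vertex e (k + 2) l * (vertex e (k + 1) (l + 1) * (vertex e k l * y)) := by
      rw [← mul_assoc, ← mul_assoc, h.vertex_zigzag_succ (by omega) (by omega),
        vertex_add_two e (by omega) (by omega), mul_assoc, ey, mul_assoc]
    rw [hxy]
    have hz := ih (l := l + 1) (by omega) (by omega) (by omega)
      (mul_mem (vertex_mem_level (R := R) e (k := k) (j := l) (k' := k + 1) (by omega)) hy)
    obtain ⟨v, hv, w, hw, hvw⟩ := Submodule.mem_sup.mp hz
    rw [← hvw, mul_add]
    refine add_mem (Submodule.mem_sup_left (vertex_mul_pathSpan e (Or.inr rfl) hv)) ?_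
    clear hvw hz hxy
    induction hw using Submodule.span_induction with
    | mem w hw =>
      obtain ⟨m, h1, h2, h3, a, ha, b, hb, rfl⟩ := hw
      have hmv := vertex_mem_level (R := R) e (k := k + 1) (j := m) le_rfl
      by_cases hml : m + 1 = l
      · subst hml
        have hL : level R e (k + 1) ≤ level R e (k + 2) := level_mono e (by omega)
        obtain ⟨r, hr⟩ := h.vertex_mul_mul_vertex (k := k + 2) (l := m + 1) (by omega) (by omega)
          (by omega) (hL (mul_mem ha hmv))
        have hr := mul_mul_mem_lower (one_mem _) (hL (mul_mem hmv hb)) hr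
        have hb' := ih (by omega) (by omega) (by omega) hb (l := m)
        obtain ⟨v, hv, w, hw, hvw⟩ := Submodule.mem_sup.mp hb'
        have hv := Submodule.smul_mem _ r (vertex_mul_pathSpan e (Or.inl rfl) hv)
        have hw := mul_mul_mem_lower
          (Subalgebra.smul_mem _ (vertex_mem_level (R := R) e (k := k + 2) (j := m + 1) le_rfl) r)
          (one_mem _) (h.lower_le_succ (by omega) hw)
        refine (Submodule.mem_sup.mpr ⟨_, hv, _, add_mem hw hr, ?_⟩)
        have hz := h.vertex_zigzag (k := k + 1) (by omega) h2
        have e1 : vertex e (k + 2) (m + 1) * (a * vertex e (k + 1) m * b) =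
            vertex e (k + 2) (m + 1) * (a * vertex e (k + 1) m) * vertex e (k + 2) (m + 1) *
              (vertex e (k + 1) m * b) := by
          nth_rewrite 1 [← hz]
          noncomm_ring
        have e2 : ∀ y z : A, r • (y * v) + (r • y * w * 1 + 1 * (z - r • y) * (v + w)) =
            z * (v + w) := by
          intro y z
          simp only [one_mul, mul_one, sub_mul, smul_mul_assoc, mul_add]
          abel
        rw [e1, ← hvw]
        exact e2 _ _
      · have := h.lower_le_succ (l := l - 1) (by omega)
          (mem_lower e (show m < l - 1 by omega) h2 h3 ha hb)
        rw [show l - 1 + 1 = l by omega] at this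
        have := mul_mul_mem_lower (vertex_mem_level (R := R) e (k := k + 2) (j := l) le_rfl)
          (one_mem _) this
        rw [mul_one] at this
        exact Submodule.mem_sup_right this
    | zero => simp
    | add x y _ _ hx hy => rw [mul_add]; exact add_mem hx hy
    | smul r x _ hx =>
      rw [mul_smul_comm]
      exact Submodule.smul_mem _ r hx

end Family

end Abstract

section Presentation

variable {R : Type} [CommRing R] {δ : R} {n : ℕ}

theorem family_TLe : Family δ n (TLe R δ n) where
  sq i h1 h2 := by
    have := RingQuot.mkAlgHom_rel R (TLRel.idem (R := R) (δ := δ) (⟨i, h1, h2⟩ : TLIdx n))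
    rw [map_mul, map_mul, AlgHom.commutes, ← Algebra.smul_def] at this
    simpa [TLe, h1, h2] using this
  up i h1 h2 := by
    have := RingQuot.mkAlgHom_rel R (TLRel.hopUp (R := R) (δ := δ)
      (⟨i, h1, by omega⟩ : TLIdx n) ⟨i + 1, by omega, h2⟩ rfl)
    rw [map_mul, map_mul] at this
    simpa [TLe, h1, h2, show i < n by omega] using this
  down i h1 h2 := by
    have := RingQuot.mkAlgHom_rel R (TLRel.hopDown (R := R) (δ := δ)
      (⟨i, h1, by omega⟩ : TLIdx n) ⟨i + 1, by omega, h2⟩ rfl)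
    rw [map_mul, map_mul] at this
    simpa [TLe, h1, h2, show i < n by omega] using this
  comm i j h1 h2 h3 := by
    have := RingQuot.mkAlgHom_rel R (TLRel.comm (R := R) (δ := δ)
      (⟨i, h1, by omega⟩ : TLIdx n) ⟨j, by omega, h3⟩ h2)
    rw [map_mul, map_mul] at this
    simpa [TLe, h1, h3, show i < n by omega, show 1 ≤ j by omega] using this

theorem level_TLe_eq_top : level R (TLe R δ n) n = ⊤ := by
  refine eq_top_iff.mpr fun x _ => ?_
  obtain ⟨y, rfl⟩ := RingQuot.mkAlgHom_surjective R (TLRel R δ n) x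
  induction y using FreeAlgebra.induction with
  | grade0 r => rw [AlgHom.commutes]; exact algebraMap_mem _ r
  | grade1 i =>
    have := mem_level (R := R) (TLe R δ n) (k := n) i.2.1 i.2.2
    rwa [TLe, dif_pos i.2] at this
  | mul a b ha hb => rw [map_mul]; exact mul_mem (ha trivial) (hb trivial)
  | add a b ha hb => rw [map_add]; exact add_mem (ha trivial) (hb trivial)

lemma mem_level_TLe (x : TL R δ n) : x ∈ level R (TLe R δ n) n := by
  rw [level_TLe_eq_top]; trivial

/-- The extension of a path by zero. -/
def pathFun {l : ℕ} (t : TLPath n l) (k : ℕ) : ℕ := if h : k < n + 1 then t.1 ⟨k, h⟩ else 0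

lemma pathFun_coe {l : ℕ} (t : TLPath n l) (k : Fin (n + 1)) : pathFun t k = t.1 k :=
  dif_pos k.2

lemma isPath_pathFun {l : ℕ} (t : TLPath n l) : IsPath (pathFun t) n l := by
  refine ⟨?_, ?_, fun j hj => ?_⟩
  · simpa [pathFun] using t.2.1
  · exact (pathFun_coe t (Fin.last n)).trans t.2.2.1
  · have := t.2.2.2 ⟨j, hj⟩
    simpa [pathFun, hj, hj.le, Nat.lt_succ_of_lt hj] using this

/-- The restriction of a function on the natural numbers to a path. -/
def IsPath.toTLPath {p : ℕ → ℕ} {l : ℕ} (h : IsPath p n l) : TLPath n l :=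
  ⟨fun k => p k, h.1, h.2.1, fun k => h.2.2 k k.2⟩

lemma IsPath.pathFun_toTLPath {p : ℕ → ℕ} {l : ℕ} (h : IsPath p n l) {k : ℕ} (hk : k ≤ n) :
    pathFun h.toTLPath k = p k :=
  pathFun_coe h.toTLPath ⟨k, by omega⟩

lemma pathFun_injective {l : ℕ} {s t : TLPath n l} (h : ∀ k ≤ n, pathFun s k = pathFun t k) :
    s = t := by
  refine Subtype.ext (funext fun k => ?_)
  rw [← pathFun_coe, ← pathFun_coe]
  exact h k (by omega)

lemma prod_reverse_ofFn {M : Type} [Monoid M] (f g : ℕ → M) (h0 : g 0 = 1)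
    (hs : ∀ k, g (k + 1) = f k * g k) (k : ℕ) :
    (List.ofFn fun j : Fin k => f j).reverse.prod = g k := by
  induction k with
  | zero => simp [h0]
  | succ k ih =>
    rw [List.ofFn_succ', hs, ← ih]
    simp

lemma dTLPath_eq {l : ℕ} (t : TLPath n l) :
    dTLPath R δ n t = pathProd (TLe R δ n) (pathFun t) n := by
  rw [← prod_reverse_ofFn (fun k => vertex (TLe R δ n) k (pathFun t k))
    (pathProd (TLe R δ n) (pathFun t)) rfl (fun _ => rfl), dTLPath]
  congr 3
  funext k
  exact congrArg _ (pathFun_coe t k.castSucc).symm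

lemma eStair_eq (k j : ℕ) : eStair R δ n k j = vertex (TLe R δ n) k j := rfl

lemma dTLPath_toTLPath {p : ℕ → ℕ} {l : ℕ} (h : IsPath p n l) :
    dTLPath R δ n h.toTLPath = pathProd (TLe R δ n) p n := by
  rw [dTLPath_eq]
  exact pathProd_congr _ fun j hj => h.pathFun_toTLPath hj.le

instance finite_TLLam : Finite (TLLam n) :=
  Finite.of_injective (fun l : TLLam n => (⟨l.1, by omega⟩ : Fin (n + 1)))
    fun a b h => Subtype.ext (by simpa using h)

instance finite_TLPath (l : ℕ) : Finite (TLPath n l) := by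
  have hb (t : TLPath n l) (k : Fin (n + 1)) : t.1 k < n + 1 := by
    obtain ⟨h0, -, hs⟩ := isPath_pathFun t
    have := IsPath.le_and_parity (p := pathFun t) (k := k) ⟨h0, rfl, fun j hj => hs j (by omega)⟩
    rw [pathFun_coe] at this
    omega
  refine Finite.of_injective (β := Fin (n + 1) → Fin (n + 1)) (fun t k => ⟨t.1 k, hb t k⟩) ?_
  intro s t h
  refine Subtype.ext (funext fun k => ?_)
  simpa using congrFun h k

end Presentation

section Involution

variable {R : Type} [CommRing R] {δ : R} {n : ℕ} {st : TL R δ n →ₗ[R] TL R δ n}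

/-- The span of the basis elements with label smaller than `l`. -/
def cellLower (st : TL R δ n →ₗ[R] TL R δ n) (l : ℕ) : Submodule R (TL R δ n) :=
  Submodule.span R {y | ∃ (m : TLLam n) (u w : TLPath n m.1), m.1 < l ∧
    y = st (dTLPath R δ n u) * eStair R δ n n m.1 * dTLPath R δ n w}

lemma st_one (hst_e : ∀ j, st (TLe R δ n j) = TLe R δ n j) : st 1 = 1 := by
  have := hst_e 0
  rwa [TLe, dif_neg (by omega)] at this

lemma st_stair (hst_mul : ∀ x y, st (x * y) = st y * st x)
    (hst_e : ∀ j, st (TLe R δ n j) = TLe R δ n j) {a m : ℕ} (ha : 1 ≤ a)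
    (hm : a + 2 * m ≤ n + 1) : st (stair (TLe R δ n) a m) = stair (TLe R δ n) a m := by
  induction m generalizing a with
  | zero => rw [stair_zero, st_one hst_e]
  | succ m ih =>
    rw [stair_succ_left, hst_mul, hst_e, ih (by omega) (by omega)]
    exact (family_TLe.commute_stair ha (by omega) (by omega)).eq.symm

lemma st_vertex (hst_mul : ∀ x y, st (x * y) = st y * st x)
    (hst_e : ∀ j, st (TLe R δ n j) = TLe R δ n j) {k j : ℕ} (hk : k ≤ n) :
    st (vertex (TLe R δ n) k j) = vertex (TLe R δ n) k j := by
  by_cases hj : j ≤ k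
  · exact st_stair hst_mul hst_e (by omega) (by omega)
  · rw [vertex, show (k - j) / 2 = 0 by omega, stair_zero, st_one hst_e]

lemma st_mem_lower (hst_mul : ∀ x y, st (x * y) = st y * st x)
    (hst_e : ∀ j, st (TLe R δ n j) = TLe R δ n j) {l : ℕ} {x : TL R δ n}
    (hx : x ∈ lower R (TLe R δ n) n l) : st x ∈ lower R (TLe R δ n) n l := by
  induction hx using Submodule.span_induction with
  | mem x hx =>
    obtain ⟨m, h1, h2, h3, a, -, b, -, rfl⟩ := hx
    rw [hst_mul, hst_mul, st_vertex hst_mul hst_e le_rfl, ← mul_assoc]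
    exact mem_lower _ h1 h2 h3 (mem_level_TLe _) (mem_level_TLe _)
  | zero => simp
  | add x y _ _ hx hy => rw [map_add]; exact add_mem hx hy
  | smul r x _ hx => rw [map_smul]; exact Submodule.smul_mem _ r hx

lemma cellLower_mono {l l' : ℕ} (h : l ≤ l') : cellLower st l ≤ cellLower st l' :=
  Submodule.span_mono fun _ ⟨m, u, w, hm, hy⟩ => ⟨m, u, w, by omega, hy⟩

lemma lower_le_cellLower (hst_mul : ∀ x y, st (x * y) = st y * st x)
    (hst_st : ∀ x, st (st x) = x)
    (hst_e : ∀ j, st (TLe R δ n j) = TLe R δ n j) (l : ℕ) :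
    lower R (TLe R δ n) n l ≤ cellLower st l := by
  induction l using Nat.strong_induction_on with
  | _ l ih =>
  refine Submodule.span_le.mpr ?_
  rintro _ ⟨m, h1, h2, h3, a, -, b, -, rfl⟩
  have hml := (ih m h1).trans (cellLower_mono (st := st) h1.le)
  have key (x : TL R δ n) := family_TLe.vertex_mul_mem le_rfl h2 h3 (mem_level_TLe x)
  have left : ∀ w : TLPath n m, ∀ z ∈ pathSpan R (TLe R δ n) n m ⊔ lower R (TLe R δ n) n m,
      st z * dTLPath R δ n w ∈ cellLower st l := by
    intro w z hz
    obtain ⟨v, hv, j, hj, rfl⟩ := Submodule.mem_sup.mp hz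
    rw [map_add, add_mul]
    refine add_mem ?_ ?_
    · clear hz
      induction hv using Submodule.span_induction with
      | mem x hx =>
        obtain ⟨p, hp, rfl⟩ := hx
        rw [hst_mul, st_vertex hst_mul hst_e le_rfl, ← dTLPath_toTLPath hp]
        exact Submodule.subset_span ⟨⟨m, h2, h3⟩, _, w, h1, rfl⟩
      | zero => simp
      | add x y _ _ hx hy => rw [map_add, add_mul]; exact add_mem hx hy
      | smul r x _ hx =>
        rw [map_smul, smul_mul_assoc]
        exact Submodule.smul_mem _ r hx
    · have := mul_mul_mem_lower (one_mem _) (mem_level_TLe (dTLPath R δ n w))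
        (st_mem_lower hst_mul hst_e hj)
      rw [one_mul] at this
      exact hml this
  obtain ⟨v, hv, j, hj, hvj⟩ := Submodule.mem_sup.mp (key b)
  rw [SetLike.mem_coe, mul_assoc, ← hvj, mul_add]
  refine add_mem ?_ ?_
  · clear hvj
    induction hv using Submodule.span_induction with
    | mem x hx =>
      obtain ⟨p, hp, rfl⟩ := hx
      have := left hp.toTLPath _ (key (st a))
      rwa [hst_mul, hst_st, st_vertex hst_mul hst_e le_rfl, dTLPath_toTLPath, mul_assoc] at this
    | zero => simp
    | add x y _ _ hx hy => rw [mul_add]; exact add_mem hx hy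
    | smul r x _ hx =>
      rw [mul_smul_comm]
      exact Submodule.smul_mem _ r hx
  · have := mul_mul_mem_lower (mem_level_TLe a) (one_mem _) hj
    rw [mul_one] at this
    exact hml this

lemma exists_sum_of_mem_pathSpan {l : ℕ} {x : TL R δ n}
    (hx : x ∈ pathSpan R (TLe R δ n) n l) : ∃ r : TLPath n l →₀ R,
      x = r.sum fun v c => c • (eStair R δ n n l * dTLPath R δ n v) := by
  have : pathSpan R (TLe R δ n) n l ≤
      Submodule.span R (Set.range fun v : TLPath n l => eStair R δ n n l * dTLPath R δ n v) := by
    refine Submodule.span_mono ?_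
    rintro _ ⟨p, hp, rfl⟩
    exact ⟨hp.toTLPath, by simp only [dTLPath_toTLPath, eStair_eq]⟩
  obtain ⟨r, hr⟩ := (Finsupp.mem_span_range_iff_exists_finsupp).mp (this hx)
  exact ⟨r, hr.symm⟩

theorem cell_mul (hst_mul : ∀ x y, st (x * y) = st y * st x)
    (hst_st : ∀ x, st (st x) = x)
    (hst_e : ∀ j, st (TLe R δ n j) = TLe R δ n j) (l : TLLam n) (t : TLPath n l.1)
    (a : TL R δ n) : ∃ r : TLPath n l.1 →₀ R, ∀ s : TLPath n l.1,
      (st (dTLPath R δ n s) * eStair R δ n n l.1 * dTLPath R δ n t) * a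
        - r.sum (fun v rv => rv •
            (st (dTLPath R δ n s) * eStair R δ n n l.1 * dTLPath R δ n v)) ∈
        cellLower st l.1 := by
  have key := family_TLe.vertex_mul_mem le_rfl l.2.1 l.2.2
    (mem_level_TLe (dTLPath R δ n t * a))
  obtain ⟨v, hv, j, hj, hvj⟩ := Submodule.mem_sup.mp key
  obtain ⟨r, hr⟩ := exists_sum_of_mem_pathSpan hv
  refine ⟨r, fun s => ?_⟩
  have hj := lower_le_cellLower hst_mul hst_st hst_e l.1
    (mul_mul_mem_lower (mem_level_TLe (st (dTLPath R δ n s))) (one_mem _) hj)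
  convert hj using 1
  rw [mul_one, eq_sub_of_add_eq' hvj, mul_sub, hr]
  congr 1
  · rw [← eStair_eq]; noncomm_ring
  · simp only [Finsupp.sum, Finset.mul_sum, mul_smul_comm, mul_assoc]

theorem cell_span (hst_mul : ∀ x y, st (x * y) = st y * st x)
    (hst_st : ∀ x, st (st x) = x)
    (hst_e : ∀ j, st (TLe R δ n j) = TLe R δ n j) :
    Submodule.span R (Set.range
      (fun p : (l : TLLam n) × (TLPath n l.1 × TLPath n l.1) =>
        st (dTLPath R δ n p.2.1) * eStair R δ n n p.1.1 * dTLPath R δ n p.2.2)) = ⊤ := by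
  refine eq_top_iff.mpr fun x _ => ?_
  have hx : x ∈ lower R (TLe R δ n) n (n + 1) := by
    have := mem_lower (TLe R δ n) (l := n + 1) (m := n) (by omega) le_rfl (by omega)
      (mem_level_TLe x) (one_mem _)
    simpa [vertex] using this
  refine Submodule.span_mono ?_ (lower_le_cellLower hst_mul hst_st hst_e _ hx)
  rintro _ ⟨m, u, w, -, rfl⟩
  exact ⟨⟨m, u, w⟩, rfl⟩

theorem cell_star (hst_mul : ∀ x y, st (x * y) = st y * st x)
    (hst_st : ∀ x, st (st x) = x)
    (hst_e : ∀ j, st (TLe R δ n j) = TLe R δ n j) (l : TLLam n) (s t : TLPath n l.1) :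
    st (st (dTLPath R δ n s) * eStair R δ n n l.1 * dTLPath R δ n t)
      - st (dTLPath R δ n t) * eStair R δ n n l.1 * dTLPath R δ n s = 0 := by
  rw [hst_mul, hst_mul, hst_st, eStair_eq, st_vertex hst_mul hst_e le_rfl, mul_assoc, sub_self]

end Involution

section Spin

/-- The state `x` with the values at `j` and `j + 1` replaced. -/
def setPair (x : ℕ → Bool) (j : ℕ) (a b : Bool) (i : ℕ) : Bool :=
  if i = j then a else if i = j + 1 then b else x i

lemma setPair_comm (x : ℕ → Bool) {j k : ℕ} (h : j + 1 < k) (a b c d : Bool) :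
    setPair (setPair x j a b) k c d = setPair (setPair x k c d) j a b := by
  funext i
  grind [setPair]

lemma setPair_setPair (x : ℕ → Bool) (j : ℕ) (a b c d : Bool) :
    setPair (setPair x j a b) j c d = setPair x j c d := by
  funext i
  grind [setPair]

@[simp] lemma setPair_left (x : ℕ → Bool) (j : ℕ) (a b : Bool) : setPair x j a b j = a := by
  simp [setPair]

@[simp] lemma setPair_right (x : ℕ → Bool) (j : ℕ) (a b : Bool) :
    setPair x j a b (j + 1) = b := by
  simp [setPair]

lemma setPair_of_ne (x : ℕ → Bool) {i j : ℕ} (a b : Bool) (h : i ≠ j) (h' : i ≠ j + 1) :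
    setPair x j a b i = x i := by
  simp [setPair, h, h']

variable {K : Type} [CommRing K]

/-- The weight of a pair of spins, with `false` the positive spin; nonzero for opposite spins. -/
def cupWeight (q : K) : Bool → Bool → K
  | false, true => 1
  | true, false => q
  | _, _ => 0

@[simp] lemma cupWeight_self (q : K) (a : Bool) : cupWeight q a a = 0 := by cases a <;> rfl

@[simp] lemma cupWeight_false_true (q : K) : cupWeight q false true = 1 := rfl

@[simp] lemma cupWeight_true_false (q : K) : cupWeight q true false = q := rfl

/-- The action of the `j`-th generator on functions of spin configurations. -/
def spinOp (q q' : K) (j : ℕ) : Module.End K ((ℕ → Bool) → K) where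
  toFun f x := q' * cupWeight q (x j) (x (j + 1)) *
    (f (setPair x j false true) + q * f (setPair x j true false))
  map_add' f g := by funext x; simp only [Pi.add_apply]; ring
  map_smul' c f := by funext x; simp only [Pi.smul_apply, smul_eq_mul, RingHom.id_apply]; ring

lemma spinOp_apply (q q' : K) (j : ℕ) (f : (ℕ → Bool) → K) (x : ℕ → Bool) :
    spinOp q q' j f x = q' * cupWeight q (x j) (x (j + 1)) *
      (f (setPair x j false true) + q * f (setPair x j true false)) := rfl

/-- The state `x` with the values at `j`, `j + 1` and `j + 2` replaced. -/
def setTriple (x : ℕ → Bool) (j : ℕ) (a b c : Bool) (i : ℕ) : Bool :=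
  if i = j then a else if i = j + 1 then b else if i = j + 2 then c else x i

lemma setTriple_self (x : ℕ → Bool) (j : ℕ) :
    setTriple x j (x j) (x (j + 1)) (x (j + 2)) = x := by
  funext i
  grind [setTriple]

lemma spinOp_setTriple (q q' : K) (j : ℕ) (f : (ℕ → Bool) → K) (x : ℕ → Bool) (a b c : Bool) :
    spinOp q q' j f (setTriple x j a b c) = q' * cupWeight q a b *
      (f (setTriple x j false true c) + q * f (setTriple x j true false c)) := by
  have (a' b' : Bool) : setPair (setTriple x j a b c) j a' b' = setTriple x j a' b' c := by
    funext i
    grind [setTriple, setPair]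
  rw [spinOp_apply, this, this]
  simp [setTriple]

lemma spinOp_succ_setTriple (q q' : K) (j : ℕ) (f : (ℕ → Bool) → K) (x : ℕ → Bool)
    (a b c : Bool) :
    spinOp q q' (j + 1) f (setTriple x j a b c) = q' * cupWeight q b c *
      (f (setTriple x j a false true) + q * f (setTriple x j a true false)) := by
  have (b' c' : Bool) : setPair (setTriple x j a b c) (j + 1) b' c' = setTriple x j a b' c' := by
    funext i
    grind [setTriple, setPair]
  rw [spinOp_apply, this, this]
  simp [setTriple, show j + 1 + 1 ≠ j by omega]

lemma family_spinOp {R : Type} [CommRing R] [Algebra R K] {δ : R} {q q' : K}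
    (hq : q * q' = 1) (hδ : algebraMap R K δ = q + q') (n : ℕ) :
    Family δ n (spinOp q q') where
  sq i _ _ := by
    ext f x
    rw [Module.End.mul_apply, LinearMap.smul_apply, Pi.smul_apply, Algebra.smul_def, hδ]
    simp only [spinOp_apply, setPair_setPair, setPair_left, setPair_right,
      cupWeight_false_true, cupWeight_true_false]
    linear_combination (q' * cupWeight q (x i) (x (i + 1)) *
      (f (setPair x i false true) + q * f (setPair x i true false))) * q * hq
  up i _ _ := by
    ext f x
    rw [← setTriple_self x i]
    simp only [Module.End.mul_apply, spinOp_setTriple, spinOp_succ_setTriple]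
    generalize x i = a, x (i + 1) = b, x (i + 2) = c
    cases a <;> cases b <;> cases c <;> simp <;> grind
  down i _ _ := by
    ext f x
    rw [← setTriple_self x i]
    simp only [Module.End.mul_apply, spinOp_setTriple, spinOp_succ_setTriple]
    generalize x i = a, x (i + 1) = b, x (i + 2) = c
    cases a <;> cases b <;> cases c <;> simp <;> grind
  comm i j _ h _ := by
    ext f x
    simp only [Module.End.mul_apply, spinOp_apply, setPair_comm x h,
      setPair_of_ne x _ _ (show i ≠ j by omega) (show i ≠ j + 1 by omega),
      setPair_of_ne x _ _ (show i + 1 ≠ j by omega) (show i + 1 ≠ j + 1 by omega),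
      setPair_of_ne x _ _ (show j ≠ i by omega) (show j ≠ i + 1 by omega),
      setPair_of_ne x _ _ (show j + 1 ≠ i by omega) (show j + 1 ≠ i + 1 by omega)]
    ring

end Spin

/-- The product of the vertices of the path `p` at the levels `0, …, k - 1`. -/
def revPathProd {A : Type} [Ring A] (e : ℕ → A) (p : ℕ → ℕ) : ℕ → A
  | 0 => 1
  | k + 1 => revPathProd e p k * vertex e k (p k)

lemma revPathProd_mem_level {R A : Type} [CommRing R] [Ring A] [Algebra R A] (e : ℕ → A)
    (p : ℕ → ℕ) (k : ℕ) : revPathProd e p k ∈ level R e k := by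
  induction k with
  | zero => exact one_mem _
  | succ k ih =>
    exact mul_mem (level_mono e (by omega) ih) (vertex_mem_level e (by omega))

section Sector

/-- The number of negative spins of `x` at the positions below `k`. -/
def minusCount (k : ℕ) (x : ℕ → Bool) : ℕ := ∑ i ∈ Finset.range k, if x i then 1 else 0

lemma minusCount_succ (k : ℕ) (x : ℕ → Bool) :
    minusCount (k + 1) x = minusCount k x + if x k then 1 else 0 :=
  Finset.sum_range_succ _ _

lemma minusCount_congr {k : ℕ} {x y : ℕ → Bool} (h : ∀ i < k, x i = y i) :
    minusCount k x = minusCount k y :=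
  Finset.sum_congr rfl fun i hi => by rw [h i (Finset.mem_range.mp hi)]

/-- The configurations with `M` negative spins up to position `k` and equal to `y` beyond. -/
def sector (k : ℕ) (y : ℕ → Bool) (M : ℕ) : Set (ℕ → Bool) :=
  {x | (∀ i, k < i → x i = y i) ∧ minusCount (k + 1) x = M}

lemma minusCount_setPair {x : ℕ → Bool} {j k : ℕ} (hj : j + 1 < k) {a b : Bool}
    (hx : x j ≠ x (j + 1)) (hab : a ≠ b) : minusCount k (setPair x j a b) = minusCount k x := by
  induction k, hj using Nat.le_induction with
  | base =>
    have : minusCount j (setPair x j a b) = minusCount j x :=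
      minusCount_congr fun i hi => setPair_of_ne x a b (by omega) (by omega)
    rw [minusCount_succ, minusCount_succ, minusCount_succ, minusCount_succ, this, setPair_left,
      setPair_right]
    revert hx hab
    generalize x j = c, x (j + 1) = d
    revert a b c d
    simp
  | succ k hk ih =>
    rw [minusCount_succ, minusCount_succ, ih, setPair_of_ne x a b (by omega) (by omega)]

lemma setPair_mem_sector {x y : ℕ → Bool} {j k M : ℕ} (hj : j < k) {a b : Bool}
    (hx : x j ≠ x (j + 1)) (hab : a ≠ b) (h : x ∈ sector k y M) :
    setPair x j a b ∈ sector k y M :=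
  ⟨fun i hi => by rw [setPair_of_ne x a b (by omega) (by omega), h.1 i hi],
    by rw [minusCount_setPair (by omega) hx hab, h.2]⟩

variable {K : Type} [CommRing K] {q q' : K}

lemma eqOn_sector_of_mem_level {k : ℕ} {D : Module.End K ((ℕ → Bool) → K)}
    (hD : D ∈ level K (spinOp q q') k) (y : ℕ → Bool) (M : ℕ) {f g : (ℕ → Bool) → K}
    (h : Set.EqOn f g (sector k y M)) : Set.EqOn (D f) (D g) (sector k y M) := by
  induction hD using Algebra.adjoin_induction generalizing f g with
  | mem D hD =>
    obtain ⟨j, h1, h2, rfl⟩ := hD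
    intro x hx
    rw [spinOp_apply, spinOp_apply]
    by_cases hxj : x j = x (j + 1)
    · rw [hxj, cupWeight_self, mul_zero, zero_mul, zero_mul]
    · rw [h (setPair_mem_sector h2 hxj (by simp) hx), h (setPair_mem_sector h2 hxj (by simp) hx)]
  | algebraMap r =>
    intro x hx
    simp [Module.algebraMap_end_apply, h hx]
  | add D E _ _ hD hE =>
    intro x hx
    simp [hD h hx, hE h hx]
  | mul D E _ _ hD hE => exact hD (hE h)

lemma apply_eq_zero_of_mem_level {k : ℕ} {D : Module.End K ((ℕ → Bool) → K)}
    (hD : D ∈ level K (spinOp q q') k) (y : ℕ → Bool) (M : ℕ) {f : (ℕ → Bool) → K}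
    (h : ∀ x ∈ sector k y M, f x = 0) {x : ℕ → Bool} (hx : x ∈ sector k y M) : D f x = 0 := by
  have := eqOn_sector_of_mem_level hD y M (g := 0) h hx
  rwa [map_zero] at this

end Sector

section Cups

variable {K : Type} [CommRing K]

/-- The product of the weights of `m` adjacent pairs, the first at `a`. -/
def cupProd (q : K) (a m : ℕ) (x : ℕ → Bool) : K :=
  ∏ r ∈ Finset.range m, cupWeight q (x (a + 2 * r)) (x (a + 2 * r + 1))

@[simp] lemma cupProd_zero (q : K) (a : ℕ) (x : ℕ → Bool) : cupProd q a 0 x = 1 := rfl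

lemma cupProd_succ (q : K) (a m : ℕ) (x : ℕ → Bool) :
    cupProd q a (m + 1) x = cupWeight q (x a) (x (a + 1)) * cupProd q (a + 2) m x := by
  rw [cupProd, Finset.prod_range_succ', mul_comm]
  congr 1
  refine Finset.prod_congr rfl fun r _ => ?_
  rw [show a + 2 * (r + 1) = a + 2 + 2 * r by omega]

lemma cupProd_congr (q : K) {a m : ℕ} {x y : ℕ → Bool} (h : ∀ i, a ≤ i → x i = y i) :
    cupProd q a m x = cupProd q a m y :=
  Finset.prod_congr rfl fun r _ => by rw [h _ (by omega), h _ (by omega)]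

/-- Straightening a staircase of cups. -/
lemma stair_spinOp_apply_mul_cupProd {q q' : K} (hq : q * q' = 1) {a m : ℕ}
    {H : (ℕ → Bool) → K} (hH : ∀ x y : ℕ → Bool, (∀ i ≤ a, x i = y i) → H x = H y)
    (x : ℕ → Bool) :
    stair (spinOp q q') a m (fun z => H z * cupProd q (a + 1) m z) x =
      cupProd q a m x * H (Function.update x a (x (a + 2 * m))) := by
  induction m generalizing a H x with
  | zero => simp
  | succ m ih =>
    have h2 : (fun z => H z * cupProd q (a + 1) (m + 1) z) = fun z =>
        (H z * cupWeight q (z (a + 1)) (z (a + 2))) * cupProd q (a + 2 + 1) m z := by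
      funext z
      rw [cupProd_succ, mul_assoc]
    rw [stair_succ_left, Module.End.mul_apply, h2, spinOp_apply, ih, ih, cupProd_succ]
    · have hc (b c : Bool) : cupProd q (a + 2) m (setPair x a b c) = cupProd q (a + 2) m x :=
        cupProd_congr q fun i hi => setPair_of_ne x b c (by omega) (by omega)
      have hs (b c : Bool) : setPair x a b c (a + 2 + 2 * m) = x (a + 2 * (m + 1)) := by
        rw [setPair_of_ne x b c (by omega) (by omega),
          show a + 2 + 2 * m = a + 2 * (m + 1) by omega]
      have hHs (b c d : Bool) : H (Function.update (setPair x a b c) (a + 2) d) =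
          H (Function.update x a b) := by
        refine hH _ _ fun i hi => ?_
        grind [Function.update, setPair]
      rw [hc, hc, hs, hs, hHs, hHs, Function.update_self, Function.update_self,
        Function.update_of_ne (by omega), Function.update_of_ne (by omega), setPair_right,
        setPair_right]
      generalize x (a + 2 * (m + 1)) = d
      cases d
      · simp
        linear_combination (cupWeight q (x a) (x (a + 1)) * cupProd q (a + 2) m x *
          H (Function.update x a false)) * hq
      · simp
        linear_combination (cupWeight q (x a) (x (a + 1)) * cupProd q (a + 2) m x *
          H (Function.update x a true)) * hq
    all_goals
      intro z w hzw
      rw [hH z w fun i hi => hzw i (by omega), hzw _ (by omega), hzw _ (by omega)]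

/-- The standard vector of the cell labelled `l` at level `k`. -/
def cellVec (q : K) (k l : ℕ) (x : ℕ → Bool) : K :=
  (if ∀ j ≤ l, x j = false then 1 else 0) * cupProd q (l + 1) ((k - l) / 2) x

lemma forall_le_eq_false_congr {x y : ℕ → Bool} {l : ℕ} (h : ∀ i ≤ l, x i = y i) :
    (∀ j ≤ l, x j = false) ↔ ∀ j ≤ l, y j = false :=
  forall₂_congr fun j hj => by rw [h j hj]

lemma forall_le_succ_update (x : ℕ → Bool) (l : ℕ) (b : Bool) :
    (∀ j ≤ l + 1, Function.update x (l + 1) b j = false) ↔ (∀ j ≤ l, x j = false) ∧ b = false := by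
  constructor
  · intro h
    refine ⟨fun j hj => ?_, ?_⟩
    · have := h j (by omega)
      rwa [Function.update_of_ne (by omega)] at this
    · have := h (l + 1) le_rfl
      rwa [Function.update_self] at this
  · rintro ⟨h, rfl⟩ j hj
    by_cases hjl : j = l + 1
    · rw [hjl, Function.update_self]
    · rw [Function.update_of_ne hjl, h j (by omega)]

lemma vertex_apply_cellVec_succ {q q' : K} (hq : q * q' = 1) {k l : ℕ} (hl : l ≤ k)
    (hp : (k - l) % 2 = 0) (x : ℕ → Bool) :
    vertex (spinOp q q') k l (cellVec q (k + 1) (l + 1)) x =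
      cellVec q k l x * if x (k + 1) = false then 1 else 0 := by
  have := stair_spinOp_apply_mul_cupProd (q := q) (q' := q') hq (a := l + 1) (m := (k - l) / 2)
    (H := fun x => if ∀ j ≤ l + 1, x j = false then 1 else 0)
    (fun x y h => by simp only [forall_le_eq_false_congr h]) x
  simp only [forall_le_succ_update] at this
  rw [show l + 1 + 2 * ((k - l) / 2) = k + 1 by omega] at this
  rw [vertex, cellVec]
  refine Eq.trans (congrArg (fun f => stair (spinOp q q') (l + 1) ((k - l) / 2) f x) ?_)
    (this.trans ?_)
  · funext z
    rw [cellVec, show (k + 1 - (l + 1)) / 2 = (k - l) / 2 by omega]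
  · split_ifs <;> simp_all

lemma vertex_apply_cellVec_pred {q q' : K} (hq : q * q' = 1) {k l : ℕ} (hl : l + 1 ≤ k)
    (hp : (k - (l + 1)) % 2 = 0) {x : ℕ → Bool} (hx : x (k + 1) = true) :
    vertex (spinOp q q') k (l + 1) (cellVec q (k + 1) l) x = cellVec q k (l + 1) x := by
  have := stair_spinOp_apply_mul_cupProd (q := q) (q' := q') hq (a := l + 2)
    (m := (k - (l + 1)) / 2)
    (H := fun x => (if ∀ j ≤ l, x j = false then 1 else 0) * cupWeight q (x (l + 1)) (x (l + 2)))
    (fun x y h => by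
      rw [h (l + 1) (by omega), h (l + 2) le_rfl]
      simp only [forall_le_eq_false_congr fun i (hi : i ≤ l) => h i (by omega)]) x
  rw [show l + 2 + 2 * ((k - (l + 1)) / 2) = k + 1 by omega, hx] at this
  rw [vertex, cellVec]
  refine Eq.trans (congrArg (fun f => stair (spinOp q q') (l + 2) ((k - (l + 1)) / 2) f x) ?_)
    (this.trans ?_)
  · funext z
    rw [cellVec, show (k + 1 - l) / 2 = (k - (l + 1)) / 2 + 1 by omega, cupProd_succ, mul_assoc]
  · rw [mul_comm, Function.update_self, Function.update_of_ne (by omega)]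
    congr 1
    have h1 : (∀ j ≤ l, Function.update x (l + 2) true j = false) ↔ ∀ j ≤ l, x j = false :=
      forall₂_congr fun j hj => by rw [Function.update_of_ne (by omega)]
    have h2 := forall_le_succ_update x l (x (l + 1))
    rw [Function.update_eq_self] at h2
    simp only [h1, h2]
    cases x (l + 1) <;> simp

end Cups

section Independence

variable {K : Type} [CommRing K] {q q' : K}

/-- The vectors attached to distinct paths are independent, even when restricted to a sector. -/
theorem eq_zero_of_sum_revPathProd (hq : q * q' = 1) {ι : Type} {k l : ℕ} (Q : Finset ι)
    (P : ι → ℕ → ℕ) (hP : ∀ i ∈ Q, IsPath (P i) k l)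
    (hinj : ∀ i ∈ Q, ∀ j ∈ Q, (∀ m ≤ k, P i m = P j m) → i = j) (c : ι → K) (y : ℕ → Bool)
    (h : ∀ x ∈ sector k y ((k - l) / 2),
      ∑ i ∈ Q, c i * revPathProd (spinOp q q') (P i) k (cellVec q k l) x = 0) :
    ∀ i ∈ Q, c i = 0 := by
  induction k generalizing l Q y with
  | zero =>
    intro i hi
    obtain rfl : l = 0 := by
      have := (hP i hi).le_and_parity
      omega
    have hQ : Q = {i} := Finset.eq_singleton_iff_unique_mem.mpr ⟨hi, fun j hj =>
      hinj j hj i hi fun m hm => by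
        obtain rfl : m = 0 := by omega
        rw [(hP i hi).1, (hP j hj).1]⟩
    have := h (Function.update y 0 false)
      ⟨fun i hi => Function.update_of_ne (by omega) _ _, by simp [minusCount]⟩
    simpa [hQ, revPathProd, cellVec] using this
  | succ k ih =>
    have hup : ∀ i ∈ Q, P i k = l + 1 → c i = 0 := by
      have hP' : ∀ i ∈ Q.filter (fun i => P i k = l + 1), IsPath (P i) k (l + 1) := by
        intro i hi
        obtain ⟨hi, hik⟩ := Finset.mem_filter.mp hi
        exact ⟨(hP i hi).1, hik, fun j hj => (hP i hi).2.2 j (by omega)⟩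
      intro i hi hik
      have hlk := (hP' i (Finset.mem_filter.mpr ⟨hi, hik⟩)).le_and_parity
      refine ih (l := l + 1) (Q.filter fun i => P i k = l + 1) hP' ?_
        (Function.update y (k + 1) true) ?_ i (Finset.mem_filter.mpr ⟨hi, hik⟩)
      · intro i hi j hj hij
        obtain ⟨hi, -⟩ := Finset.mem_filter.mp hi
        obtain ⟨hj, -⟩ := Finset.mem_filter.mp hj
        refine hinj i hi j hj fun m hm => ?_
        obtain hm | rfl := Nat.le_succ_iff.mp hm
        · exact hij m hm
        · rw [(hP i hi).2.1, (hP j hj).2.1]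
      · intro x hx
        have htop {z : ℕ → Bool}
            (hz : z ∈ sector k (Function.update y (k + 1) true) ((k - (l + 1)) / 2)) :
            z (k + 1) = true := by
          rw [hz.1 (k + 1) (by omega), Function.update_self]
        have := h x ⟨fun j hj => by
            rw [hx.1 j (by omega), Function.update_of_ne (by omega)], by
            rw [minusCount_succ, hx.2, htop hx, if_pos rfl]; omega⟩
        rw [← this, Finset.sum_filter]
        refine Finset.sum_congr rfl fun i hi => ?_
        rw [revPathProd, Module.End.mul_apply]
        have hD := revPathProd_mem_level (R := K) (spinOp q q') (P i) k
        split_ifs with hik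
        · congr 1
          refine eqOn_sector_of_mem_level hD _ _ (fun z hz => ?_) hx
          rw [hik, vertex_apply_cellVec_pred hq hlk.1 hlk.2 (htop hz)]
        · rw [apply_eq_zero_of_mem_level hD _ _ (fun z hz => ?_) hx, mul_zero]
          have hs := (hP i hi).2.2 k (by omega)
          rw [(hP i hi).2.1] at hs
          obtain rfl : l = P i k + 1 := by omega
          rw [vertex_apply_cellVec_succ hq (by omega) (by omega), htop hz]
          simp
    intro i hi
    by_cases hik : P i k = l + 1
    · exact hup i hi hik
    have hP' : ∀ i ∈ Q.filter (fun i => P i k + 1 = l), IsPath (P i) k (l - 1) := by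
      intro i hi
      obtain ⟨hi, hik⟩ := Finset.mem_filter.mp hi
      exact ⟨(hP i hi).1, by omega, fun j hj => (hP i hi).2.2 j (by omega)⟩
    have hstep (i : ι) (hi : i ∈ Q) (hik : P i k ≠ l + 1) : P i k + 1 = l := by
      have hs := (hP i hi).2.2 k (by omega)
      rw [(hP i hi).2.1] at hs
      omega
    have hiF : i ∈ Q.filter (fun i => P i k + 1 = l) := Finset.mem_filter.mpr ⟨hi, hstep i hi hik⟩
    have hlk := (hP' i hiF).le_and_parity
    have hl := hstep i hi hik
    refine ih (l := l - 1) (Q.filter fun i => P i k + 1 = l) hP' ?_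
      (Function.update y (k + 1) false) ?_ i hiF
    · intro i hi j hj hij
      obtain ⟨hi, -⟩ := Finset.mem_filter.mp hi
      obtain ⟨hj, -⟩ := Finset.mem_filter.mp hj
      refine hinj i hi j hj fun m hm => ?_
      obtain hm | rfl := Nat.le_succ_iff.mp hm
      · exact hij m hm
      · rw [(hP i hi).2.1, (hP j hj).2.1]
    · intro x hx
      have htop {z : ℕ → Bool}
          (hz : z ∈ sector k (Function.update y (k + 1) false) ((k - (l - 1)) / 2)) :
          z (k + 1) = false := by
        rw [hz.1 (k + 1) (by omega), Function.update_self]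
      have := h x ⟨fun j hj => by
          rw [hx.1 j (by omega), Function.update_of_ne (by omega)], by
          rw [minusCount_succ, hx.2, htop hx]; simp; omega⟩
      rw [← this, Finset.sum_filter]
      refine Finset.sum_congr rfl fun i hi => ?_
      split_ifs with hik
      · rw [revPathProd, Module.End.mul_apply]
        congr 1
        refine eqOn_sector_of_mem_level (revPathProd_mem_level _ _ _) _ _ (fun z hz => ?_) hx
        subst hik
        rw [vertex_apply_cellVec_succ hq (by omega) (by omega), htop hz]
        simp
      · rw [hup i hi (by by_contra hne; exact hik (hstep i hi hne)), zero_mul]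

end Independence

section Collapse

variable {K : Type} [CommRing K] {q q' : K}

/-- The configuration `x` with `m` positive-negative pairs inserted from position `a` on. -/
def cupState (a m : ℕ) (x : ℕ → Bool) (i : ℕ) : Bool :=
  if a ≤ i ∧ i < a + 2 * m then decide ((i - a) % 2 = 1) else x i

lemma setPair_cupState (a m : ℕ) (x : ℕ → Bool) (b c : Bool) :
    setPair (cupState a (m + 1) x) a b c = cupState (a + 2) m (setPair x a b c) := by
  funext i
  simp only [setPair, cupState]
  by_cases h1 : i = a
  · simp [h1]
  by_cases h2 : i = a + 1
  · simp [h2]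
  simp only [if_neg h1, if_neg h2]
  by_cases h3 : a + 2 ≤ i ∧ i < a + 2 + 2 * m
  · rw [if_pos h3, if_pos (by omega), show (i - a) % 2 = (i - (a + 2)) % 2 by omega]
  · rw [if_neg h3, if_neg (by omega)]

lemma stair_spinOp_apply (a m : ℕ) (f : (ℕ → Bool) → K) (x : ℕ → Bool) :
    stair (spinOp q q') a m f x =
      cupProd q a m x * stair (spinOp q q') a m f (cupState a m x) := by
  induction m generalizing a x with
  | zero =>
    have : cupState a 0 x = x := by
      funext i
      exact if_neg (by omega)
    rw [this, cupProd_zero, one_mul]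
  | succ m ih =>
    have hc (b c : Bool) : stair (spinOp q q') (a + 2) m f (setPair x a b c) =
        cupProd q (a + 2) m x *
          stair (spinOp q q') (a + 2) m f (setPair (cupState a (m + 1) x) a b c) := by
      rw [ih, setPair_cupState]
      congr 1
      exact cupProd_congr q fun i hi => setPair_of_ne x b c (by omega) (by omega)
    have h0 : cupState a (m + 1) x a = false := by simp [cupState]
    have h1 : cupState a (m + 1) x (a + 1) = true := by
      rw [cupState, if_pos (by omega)]
      simp
    rw [stair_succ_left, Module.End.mul_apply, spinOp_apply, spinOp_apply, hc, hc, h0, h1,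
      cupProd_succ, cupWeight_false_true]
    ring

lemma minusCount_of_cupProd_ne_zero {a m : ℕ} {x : ℕ → Bool} (h : cupProd q a m x ≠ 0) :
    minusCount (a + 2 * m) x = minusCount a x + m := by
  induction m with
  | zero => rfl
  | succ m ih =>
    rw [cupProd, Finset.prod_range_succ] at h
    have ih := ih (left_ne_zero_of_mul h)
    have h2 := right_ne_zero_of_mul h
    rw [show a + 2 * (m + 1) = a + 2 * m + 1 + 1 by omega, minusCount_succ, minusCount_succ, ih]
    revert h2
    cases x (a + 2 * m) <;> cases x (a + 2 * m + 1) <;> simp <;> omega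

lemma minusCount_of_mem_sector {k l M : ℕ} {x y : ℕ → Bool} (hl : l ≤ k)
    (hp : (k - l) % 2 = 0) (hx : x ∈ sector k y M) (h : cupProd q (l + 1) ((k - l) / 2) x ≠ 0) :
    M = minusCount (l + 1) x + (k - l) / 2 := by
  rw [← minusCount_of_cupProd_ne_zero h, ← hx.2]
  congr 1
  omega

lemma vertex_apply_of_lt {k l M : ℕ} {x y : ℕ → Bool} (hl : l ≤ k) (hp : (k - l) % 2 = 0)
    (hx : x ∈ sector k y M) (hM : M < (k - l) / 2) (f : (ℕ → Bool) → K) :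
    vertex (spinOp q q') k l f x = 0 := by
  rw [vertex, stair_spinOp_apply]
  by_cases h : cupProd q (l + 1) ((k - l) / 2) x = 0
  · rw [h, zero_mul]
  · have := minusCount_of_mem_sector hl hp hx h
    omega

/-- The configuration supporting the staircase `l` at level `k`, equal to `y` beyond `k`. -/
def cellState (k l : ℕ) (y : ℕ → Bool) : ℕ → Bool :=
  cupState (l + 1) ((k - l) / 2) fun i => if i ≤ k then false else y i

lemma vertex_apply_of_mem_sector {k l : ℕ} {x y : ℕ → Bool} (hl : l ≤ k)
    (hp : (k - l) % 2 = 0) (hx : x ∈ sector k y ((k - l) / 2)) (f : (ℕ → Bool) → K) :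
    vertex (spinOp q q') k l f x =
      cellVec q k l x * vertex (spinOp q q') k l f (cellState k l y) := by
  rw [vertex, stair_spinOp_apply, cellVec]
  by_cases h : cupProd q (l + 1) ((k - l) / 2) x = 0
  · rw [h]; simp
  have h0 : minusCount (l + 1) x = 0 := by
    have := minusCount_of_mem_sector hl hp hx h
    omega
  have hx0 : ∀ j ≤ l, x j = false := by
    intro j hj
    have := Finset.sum_eq_zero_iff.mp h0 j (Finset.mem_range.mpr (by omega))
    simpa using this
  rw [if_pos hx0, one_mul]
  congr 1
  refine congrArg _ (funext fun i => ?_)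
  by_cases h1 : l + 1 ≤ i ∧ i < l + 1 + 2 * ((k - l) / 2)
  · simp only [cellState, cupState, if_pos h1]
  · simp only [cellState, cupState, if_neg h1]
    split_ifs
    · exact hx0 i (by omega)
    · exact hx.1 i (by omega)

/-- The function supported at the configuration `z`, with value one. -/
def pointMass (z : ℕ → Bool) : (ℕ → Bool) → K := Set.indicator {z} 1

lemma pointMass_self (z : ℕ → Bool) : pointMass (K := K) z z = 1 :=
  Set.indicator_of_mem (Set.mem_singleton z) 1

lemma pointMass_of_ne {x z : ℕ → Bool} (h : x ≠ z) : pointMass (K := K) z x = 0 :=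
  Set.indicator_of_notMem h 1

lemma stair_spinOp_pointMass_of_ne {a m : ℕ} {x z : ℕ → Bool} {i : ℕ} (hi : i < a)
    (h : x i ≠ z i) : stair (spinOp q q') a m (pointMass z) x = 0 := by
  induction m generalizing a x with
  | zero => exact pointMass_of_ne fun hxz => h (by rw [hxz])
  | succ m ih =>
    have hc (b c : Bool) :
        stair (spinOp q q') (a + 2) m (pointMass z) (setPair x a b c) = 0 :=
      ih (by omega) (by rwa [setPair_of_ne x b c (by omega) (by omega)])
    rw [stair_succ_left, Module.End.mul_apply, spinOp_apply, hc, hc]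
    simp

lemma stair_spinOp_pointMass_self {a m : ℕ} {z : ℕ → Bool}
    (h : ∀ r < m, z (a + 2 * r) = false ∧ z (a + 2 * r + 1) = true) :
    stair (spinOp q q') a m (pointMass z) z = q' ^ m := by
  induction m generalizing a with
  | zero => rw [stair_zero, pow_zero, Module.End.one_apply, pointMass_self]
  | succ m ih =>
    have h0 := h 0 (by omega)
    rw [mul_zero, add_zero] at h0
    have hz : setPair z a false true = z := by
      funext i
      grind [setPair]
    have h1 : stair (spinOp q q') (a + 2) m (pointMass (K := K) z) z = q' ^ m := ih fun r hr => by
      have := h (r + 1) (by omega)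
      rwa [show a + 2 * (r + 1) = a + 2 + 2 * r by omega] at this
    have h2 : stair (spinOp q q') (a + 2) m (pointMass z) (setPair z a true false) = 0 :=
      stair_spinOp_pointMass_of_ne (i := a) (by omega) (by simp [h0.1])
    rw [stair_succ_left, Module.End.mul_apply, spinOp_apply, hz, h1, h2, h0.1, h0.2,
      cupWeight_false_true]
    ring

lemma vertex_spinOp_pointMass_cellState (k l : ℕ) (y : ℕ → Bool) :
    vertex (spinOp q q') k l (pointMass (cellState k l y)) (cellState k l y) =
      q' ^ ((k - l) / 2) := by
  refine stair_spinOp_pointMass_self fun r hr => ⟨?_, ?_⟩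
  · rw [cellState, cupState, if_pos (by omega)]
    simp
  · rw [cellState, cupState, if_pos (by omega),
      show l + 1 + 2 * r + 1 - (l + 1) = 2 * r + 1 by omega]
    simp

end Collapse

section Pairing

variable {K : Type} [CommRing K] {q q' : K}

lemma finite_eq_beyond (n : ℕ) (y : ℕ → Bool) : {x : ℕ → Bool | ∀ i, n < i → x i = y i}.Finite := by
  refine Set.Finite.of_finite_image (f := fun x (i : Fin (n + 1)) => x i) (Set.toFinite _) ?_
  intro x hx z hz h
  funext i
  by_cases hi : i < n + 1
  · exact congrFun h ⟨i, hi⟩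
  · rw [hx i (by omega), hz i (by omega)]

/-- The configurations equal to `y` beyond `n`. -/
def box (n : ℕ) (y : ℕ → Bool) : Finset (ℕ → Bool) := (finite_eq_beyond n y).toFinset

lemma mem_box {n : ℕ} {x y : ℕ → Bool} : x ∈ box n y ↔ ∀ i, n < i → x i = y i := by
  simp [box]

lemma setPair_self (x : ℕ → Bool) (j : ℕ) : setPair x j (x j) (x (j + 1)) = x := by
  funext i
  grind [setPair]

lemma spinOp_apply_swap (hq : q * q' = 1) (j : ℕ) (f : (ℕ → Bool) → K) (x : ℕ → Bool) :
    spinOp q q' j f x = if x j = x (j + 1) then 0 else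
      (if x j then q else q') * f x + f (setPair x j (x (j + 1)) (x j)) := by
  have hx : f x = f (setPair x j (x j) (x (j + 1))) := by rw [setPair_self]
  rw [spinOp_apply, hx]
  generalize x j = a, x (j + 1) = b
  cases a <;> cases b <;> simp <;> grind

lemma sum_spinOp_mul (hq : q * q' = 1) {n j : ℕ} (hj : j < n) (y : ℕ → Bool)
    (f g : (ℕ → Bool) → K) :
    ∑ x ∈ box n y, spinOp q q' j f x * g x = ∑ x ∈ box n y, f x * spinOp q q' j g x := by
  let σ (x : ℕ → Bool) : ℕ → Bool := setPair x j (x (j + 1)) (x j)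
  have hσ (x) : σ (σ x) = x := by
    simp only [σ, setPair_left, setPair_right, setPair_setPair, setPair_self]
  have hbox : ∀ x ∈ box n y, σ x ∈ box n y := fun x hx => mem_box.mpr fun i hi => by
    simp only [σ]
    rw [setPair_of_ne x _ _ (by omega) (by omega), mem_box.mp hx i hi]
  have h1 : ∑ x ∈ box n y, (if x j = x (j + 1) then 0 else f (σ x) * g x) =
      ∑ x ∈ box n y, if x j = x (j + 1) then 0 else f x * g (σ x) := by
    refine Finset.sum_nbij' σ σ hbox hbox (fun x _ => hσ x) (fun x _ => hσ x) fun x _ => ?_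
    rw [hσ]
    simp only [σ, setPair_left, setPair_right, eq_comm]
  have h2 (x : ℕ → Bool) : spinOp q q' j f x * g x =
      (if x j = x (j + 1) then 0 else (if x j then q else q') * f x * g x) +
        if x j = x (j + 1) then 0 else f (σ x) * g x := by
    rw [spinOp_apply_swap hq]
    split_ifs <;> ring
  have h3 (x : ℕ → Bool) : f x * spinOp q q' j g x =
      (if x j = x (j + 1) then 0 else (if x j then q else q') * f x * g x) +
        if x j = x (j + 1) then 0 else f x * g (σ x) := by
    rw [spinOp_apply_swap hq]
    split_ifs <;> ring
  simp only [h2, h3, Finset.sum_add_distrib, h1]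

end Pairing

section Map

variable {R A B : Type} [CommRing R] [Ring A] [Ring B] [Algebra R A] [Algebra R B]
  {e : ℕ → A} {e' : ℕ → B} {n : ℕ} (f : A →ₐ[R] B)

lemma map_vertex (h : ∀ j, 1 ≤ j → j < n → f (e j) = e' j) {k j : ℕ} (hk : k ≤ n) :
    f (vertex e k j) = vertex e' k j := by
  rw [vertex, vertex, stair, stair, map_list_prod, List.map_map]
  congr 1
  refine List.map_congr_left fun t ht => ?_
  have := List.mem_range.mp ht
  exact h _ (by omega) (by omega)

lemma map_revPathProd (h : ∀ j, 1 ≤ j → j < n → f (e j) = e' j) (p : ℕ → ℕ) {k : ℕ}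
    (hk : k ≤ n) : f (revPathProd e p k) = revPathProd e' p k := by
  induction k with
  | zero => exact map_one f
  | succ k ih => rw [revPathProd, map_mul, ih (by omega), map_vertex f h (by omega), revPathProd]

end Map

section Representation

variable {R K : Type} [CommRing R] [CommRing K] [Algebra R K] {δ : R} {n : ℕ} {q q' : K}

/-- The representation of the Temperley–Lieb algebra on functions of spin configurations. -/
def spinRep (hq : q * q' = 1) (hδ : algebraMap R K δ = q + q') :
    TL R δ n →ₐ[R] Module.End K ((ℕ → Bool) → K) :=
  RingQuot.liftAlgHom R ⟨FreeAlgebra.lift R fun i : TLIdx n => spinOp q q' i.1, by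
    have hF := family_spinOp (R := R) hq hδ n
    rintro _ _ (i | ⟨i, ⟨_, hj⟩, rfl⟩ | ⟨i, ⟨_, hj⟩, rfl⟩ | ⟨i, j, h⟩)
    · simp only [map_mul, FreeAlgebra.lift_ι_apply, AlgHom.commutes]
      rw [hF.sq _ i.2.1 i.2.2, Algebra.smul_def]
    · simp only [map_mul, FreeAlgebra.lift_ι_apply]
      exact hF.up _ i.2.1 hj.2
    · simp only [map_mul, FreeAlgebra.lift_ι_apply]
      exact hF.down _ i.2.1 hj.2
    · simp only [map_mul, FreeAlgebra.lift_ι_apply]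
      exact hF.comm _ _ i.2.1 h j.2.2⟩

lemma spinRep_TLe (hq : q * q' = 1) (hδ : algebraMap R K δ = q + q') {j : ℕ} (h1 : 1 ≤ j)
    (h2 : j < n) : spinRep hq hδ (TLe R δ n j) = spinOp q q' j := by
  rw [TLe, dif_pos ⟨h1, h2⟩, spinRep, RingQuot.liftAlgHom_mkAlgHom_apply]
  exact FreeAlgebra.lift_ι_apply _ _

variable {st : TL R δ n →ₗ[R] TL R δ n}

lemma sum_spinRep_mul (hq : q * q' = 1) (hδ : algebraMap R K δ = q + q')
    (hst_mul : ∀ x y, st (x * y) = st y * st x) (hst_e : ∀ j, st (TLe R δ n j) = TLe R δ n j)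
    (y : ℕ → Bool) (a : TL R δ n) (f g : (ℕ → Bool) → K) :
    ∑ x ∈ box n y, spinRep hq hδ a f x * g x =
      ∑ x ∈ box n y, f x * spinRep hq hδ (st a) g x := by
  induction mem_level_TLe a using Algebra.adjoin_induction generalizing f g with
  | mem a ha =>
    obtain ⟨j, h1, h2, rfl⟩ := ha
    rw [hst_e, spinRep_TLe hq hδ h1 h2, sum_spinOp_mul hq h2]
  | algebraMap r =>
    rw [Algebra.algebraMap_eq_smul_one, map_smul, map_smul, st_one hst_e, map_smul, map_one]
    refine Finset.sum_congr rfl fun x _ => ?_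
    simp only [LinearMap.smul_apply, Module.End.one_apply, Pi.smul_apply]
    rw [Algebra.smul_def, Algebra.smul_def]
    ring
  | add a b _ _ ha hb =>
    simp only [map_add, LinearMap.add_apply, Pi.add_apply, add_mul, mul_add,
      Finset.sum_add_distrib, ha, hb]
  | mul a b _ _ ha hb =>
    rw [hst_mul, map_mul, map_mul, Module.End.mul_apply, Module.End.mul_apply, ha, hb]

lemma spinRep_pointMass (hq : q * q' = 1) (hδ : algebraMap R K δ = q + q')
    (hst_mul : ∀ x y, st (x * y) = st y * st x) (hst_e : ∀ j, st (TLe R δ n j) = TLe R δ n j)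
    {x y z : ℕ → Bool} (hx : x ∈ box n y) (hz : z ∈ box n y) (a : TL R δ n) :
    spinRep hq hδ a (pointMass x) z = spinRep hq hδ (st a) (pointMass z) x := by
  have := sum_spinRep_mul hq hδ hst_mul hst_e y a (pointMass x) (pointMass z)
  rwa [Finset.sum_eq_single_of_mem z hz fun b _ hb => by rw [pointMass_of_ne hb, mul_zero],
    Finset.sum_eq_single_of_mem x hx fun b _ hb => by rw [pointMass_of_ne hb, zero_mul],
    pointMass_self, pointMass_self, mul_one, one_mul] at this

lemma st_pathProd (hst_mul : ∀ x y, st (x * y) = st y * st x)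
    (hst_e : ∀ j, st (TLe R δ n j) = TLe R δ n j) (p : ℕ → ℕ) {k : ℕ} (hk : k ≤ n) :
    st (pathProd (TLe R δ n) p k) = revPathProd (TLe R δ n) p k := by
  induction k with
  | zero => exact st_one hst_e
  | succ k ih =>
    rw [pathProd, hst_mul, st_vertex hst_mul hst_e (by omega), ih (by omega), revPathProd]

lemma spinRep_st_dTLPath (hq : q * q' = 1) (hδ : algebraMap R K δ = q + q')
    (hst_mul : ∀ x y, st (x * y) = st y * st x) (hst_e : ∀ j, st (TLe R δ n j) = TLe R δ n j)
    {l : ℕ} (t : TLPath n l) :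
    spinRep hq hδ (st (dTLPath R δ n t)) = revPathProd (spinOp q q') (pathFun t) n := by
  rw [dTLPath_eq, st_pathProd hst_mul hst_e _ le_rfl]
  exact map_revPathProd _ (fun j h1 h2 => spinRep_TLe hq hδ h1 h2) _ le_rfl

lemma spinRep_vertex (hq : q * q' = 1) (hδ : algebraMap R K δ = q + q') (l : ℕ) :
    spinRep hq hδ (vertex (TLe R δ n) n l) = vertex (spinOp q q') n l :=
  map_vertex _ (fun _ h1 h2 => spinRep_TLe hq hδ h1 h2) le_rfl

lemma cellState_mem_box {l : ℕ} (hl : l ≤ n) (y : ℕ → Bool) : cellState n l y ∈ box n y :=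
  mem_box.mpr fun i hi => by
    rw [cellState, cupState, if_neg (by omega), if_neg (by omega)]

lemma vertex_mul_dTLPath_pointMass (hq : q * q' = 1) (hδ : algebraMap R K δ = q + q')
    (hst_mul : ∀ x y, st (x * y) = st y * st x) (hst_e : ∀ j, st (TLe R δ n j) = TLe R δ n j)
    (l : TLLam n) (t : TLPath n l.1) {x y : ℕ → Bool} (hx : x ∈ sector n y ((n - l.1) / 2)) :
    vertex (spinOp q q') n l.1 (spinRep hq hδ (dTLPath R δ n t) (pointMass x))
        (cellState n l.1 y) =
      q' ^ ((n - l.1) / 2) *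
        revPathProd (spinOp q q') (pathFun t) n (cellVec q n l.1) x := by
  have := spinRep_pointMass hq hδ hst_mul hst_e (mem_box.mpr hx.1) (cellState_mem_box l.2.1 y)
    (vertex (TLe R δ n) n l.1 * dTLPath R δ n t)
  rw [hst_mul, map_mul, map_mul, st_vertex hst_mul hst_e le_rfl, spinRep_vertex,
    spinRep_st_dTLPath hq hδ hst_mul hst_e, Module.End.mul_apply, Module.End.mul_apply] at this
  rw [this, ← smul_eq_mul, ← Pi.smul_apply, ← map_smul]
  refine eqOn_sector_of_mem_level (revPathProd_mem_level _ _ _) _ _ (fun z hz => ?_) hx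
  rw [vertex_apply_of_mem_sector l.2.1 l.2.2 hz, vertex_spinOp_pointMass_cellState, mul_comm,
    Pi.smul_apply, smul_eq_mul]

theorem cell_linearIndependent (hq : q * q' = 1) (hδ : algebraMap R K δ = q + q')
    (hinj : Function.Injective (algebraMap R K))
    (hst_mul : ∀ x y, st (x * y) = st y * st x)
    (hst_e : ∀ j, st (TLe R δ n j) = TLe R δ n j) :
    LinearIndependent R (fun p : (l : TLLam n) × (TLPath n l.1 × TLPath n l.1) =>
      st (dTLPath R δ n p.2.1) * eStair R δ n n p.1.1 * dTLPath R δ n p.2.2) := by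
  have : Fintype (TLLam n) := Fintype.ofFinite _
  have (l : ℕ) : Fintype (TLPath n l) := Fintype.ofFinite _
  rw [Fintype.linearIndependent_iff]
  intro c hc
  let y : ℕ → Bool := fun _ => false
  have hsum (f : (ℕ → Bool) → K) (x : ℕ → Bool) :
      ∑ l : TLLam n, ∑ s : TLPath n l.1, ∑ t : TLPath n l.1, algebraMap R K (c ⟨l, s, t⟩) *
        revPathProd (spinOp q q') (pathFun s) n
          (vertex (spinOp q q') n l.1 (spinRep hq hδ (dTLPath R δ n t) f)) x = 0 := by
    have := congrFun (LinearMap.congr_fun (congrArg (spinRep hq hδ) hc) f) x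
    rw [map_sum, map_zero, LinearMap.sum_apply, Finset.sum_apply, Fintype.sum_sigma] at this
    simp only [Fintype.sum_prod_type, map_smul, map_mul, LinearMap.smul_apply, Pi.smul_apply,
      spinRep_st_dTLPath hq hδ hst_mul hst_e, eStair_eq, spinRep_vertex,
      Module.End.mul_apply] at this
    simp only [Algebra.smul_def] at this
    exact this
  have key : ∀ d, ∀ l : TLLam n, n - l.1 = d → ∀ s t, c ⟨l, s, t⟩ = 0 := by
    intro d
    induction d using Nat.strong_induction_on with
    | _ d ih =>
    intro l hd
    have hl : ∀ f : (ℕ → Bool) → K, ∀ s : TLPath n l.1,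
        ∑ t : TLPath n l.1, algebraMap R K (c ⟨l, s, t⟩) *
          vertex (spinOp q q') n l.1 (spinRep hq hδ (dTLPath R δ n t) f) (cellState n l.1 y)
          = 0 := by
      intro f s
      refine eq_zero_of_sum_revPathProd hq Finset.univ pathFun (fun s _ => isPath_pathFun s)
        (fun _ _ _ _ => pathFun_injective)
        (fun s => ∑ t : TLPath n l.1, algebraMap R K (c ⟨l, s, t⟩) *
          vertex (spinOp q q') n l.1 (spinRep hq hδ (dTLPath R δ n t) f) (cellState n l.1 y))
        y ?_ s (Finset.mem_univ s)
      intro x hx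
      have h0 := hsum f x
      rw [Finset.sum_eq_single_of_mem l (Finset.mem_univ l)] at h0
      · rw [← h0]
        refine Finset.sum_congr rfl fun s _ => ?_
        rw [Finset.sum_mul]
        refine Finset.sum_congr rfl fun t _ => ?_
        rw [mul_assoc]
        congr 1
        rw [← smul_eq_mul, ← Pi.smul_apply, ← map_smul]
        refine eqOn_sector_of_mem_level (revPathProd_mem_level _ _ _) _ _ (fun z hz => ?_) hx
        rw [vertex_apply_of_mem_sector l.2.1 l.2.2 hz, mul_comm, Pi.smul_apply, smul_eq_mul]
      · intro m _ hml
        refine Finset.sum_eq_zero fun s _ => Finset.sum_eq_zero fun t _ => ?_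
        obtain hlt | hgt := lt_or_gt_of_ne fun h => hml (Subtype.ext h)
        · rw [apply_eq_zero_of_mem_level (revPathProd_mem_level _ _ _) _ _ (fun z hz => ?_) hx,
            mul_zero]
          exact vertex_apply_of_lt m.2.1 m.2.2 hz (by omega) _
        · rw [ih (n - m.1) (by omega) m rfl, map_zero, zero_mul]
    intro s t
    have hst := eq_zero_of_sum_revPathProd hq Finset.univ pathFun
      (fun t _ => isPath_pathFun t) (fun _ _ _ _ => pathFun_injective)
      (fun t => algebraMap R K (c ⟨l, s, t⟩) * q' ^ ((n - l.1) / 2)) y (fun x hx => by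
        rw [← hl (pointMass x) s]
        refine Finset.sum_congr rfl fun t _ => ?_
        rw [vertex_mul_dTLPath_pointMass hq hδ hst_mul hst_e l t hx, mul_assoc]) t
      (Finset.mem_univ t)
    have hu : IsUnit (q' ^ ((n - l.1) / 2)) :=
      (IsUnit.of_mul_eq_one q (by rw [mul_comm, hq])).pow _
    exact (map_eq_zero_iff _ hinj).mp ((hu.mul_left_eq_zero).mp hst)
  rintro ⟨l, s, t⟩
  exact key _ l rfl s t

end Representation

section Root

open Polynomial

/-- Some ring extension contains a unit whose sum with its inverse is the indeterminate. -/
lemma exists_sum_inverse : ∃ (K : Type) (_ : CommRing K) (_ : Algebra ℤ[X] K) (q q' : K),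
    q * q' = 1 ∧ algebraMap ℤ[X] K X = q + q' ∧ Function.Injective (algebraMap ℤ[X] K) := by
  let g : ℤ[X][X] := X ^ 2 - C X * X + 1
  refine ⟨AdjoinRoot g, inferInstance, inferInstance, AdjoinRoot.root g,
    algebraMap ℤ[X] _ X - AdjoinRoot.root g, ?_, by ring, ?_⟩
  · have h : AdjoinRoot.root g ^ 2 - algebraMap ℤ[X] _ X * AdjoinRoot.root g + 1 = 0 := by
      have := AdjoinRoot.eval₂_root g
      simpa [g] using this
    linear_combination -h
  · refine AdjoinRoot.of.injective_of_degree_ne_zero ?_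
    have h : g.degree = 2 := by simp only [g]; compute_degree!
    rw [h]
    exact two_ne_zero

end Root

end TemperleyLieb

/-- **Statement 17** (Murphy-type cellular basis of the Temperley–Lieb algebra).
Let `R = ℤ[δ]` be the generic ground ring (with `δ` an indeterminate) and let
`A_i = TL R δ i` be the Temperley–Lieb algebra, with its involution `*` fixing the
generators `e_j`.  With `c_l = e^{((i-l)/2)}_{i-1}` and the path elements `d_t` as
above, for each `i ≥ 1` the set
`𝒜_i = {d_s* c_l d_t : l ∈ Â_i, s, t ∈ Â_i^l}` is an `R`-basis of `A_i`, and
`(A_i, *, Â_i, ⊵, 𝒜_i)` is a cell datum for `A_i` (the poset and the index sets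
being finite, and the two cellular axioms holding with respect to the order
`m ▷ l ↔ m < l`). -/
theorem temperley_lieb_cellular_basis
    (i : ℕ) (hi : 1 ≤ i)
    -- the involution of A_i, fixing the generators
    (st : TL (Polynomial ℤ) Polynomial.X i →ₗ[Polynomial ℤ]
      TL (Polynomial ℤ) Polynomial.X i)
    (hst_mul : ∀ x y, st (x * y) = st y * st x)
    (hst_st : ∀ x, st (st x) = x)
    (hst_e : ∀ j : ℕ, st (TLe (Polynomial ℤ) Polynomial.X i j)
      = TLe (Polynomial ℤ) Polynomial.X i j) :
    -- the set 𝒜_i is an R-basis of A_i ...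
    (LinearIndependent (Polynomial ℤ)
      (fun p : (l : TLLam i) × (TLPath i l.1 × TLPath i l.1) =>
        st (dTLPath (Polynomial ℤ) Polynomial.X i p.2.1) *
          eStair (Polynomial ℤ) Polynomial.X i i p.1.1 *
          dTLPath (Polynomial ℤ) Polynomial.X i p.2.2) ∧
    Submodule.span (Polynomial ℤ) (Set.range
      (fun p : (l : TLLam i) × (TLPath i l.1 × TLPath i l.1) =>
        st (dTLPath (Polynomial ℤ) Polynomial.X i p.2.1) *
          eStair (Polynomial ℤ) Polynomial.X i i p.1.1 *
          dTLPath (Polynomial ℤ) Polynomial.X i p.2.2)) = ⊤) ∧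
    -- ... the poset and the index sets are finite ...
    (Finite (TLLam i) ∧ ∀ l : TLLam i, Finite (TLPath i l.1)) ∧
    -- ... the cellular multiplication axiom holds ...
    (∀ (l : TLLam i) (t : TLPath i l.1) (a : TL (Polynomial ℤ) Polynomial.X i),
      ∃ r : TLPath i l.1 →₀ Polynomial ℤ, ∀ s : TLPath i l.1,
        (st (dTLPath (Polynomial ℤ) Polynomial.X i s) *
            eStair (Polynomial ℤ) Polynomial.X i i l.1 *
            dTLPath (Polynomial ℤ) Polynomial.X i t) * a
          - r.sum (fun v rv => rv •
              (st (dTLPath (Polynomial ℤ) Polynomial.X i s) *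
                eStair (Polynomial ℤ) Polynomial.X i i l.1 *
                dTLPath (Polynomial ℤ) Polynomial.X i v)) ∈
        Submodule.span (Polynomial ℤ)
          {y | ∃ (m : TLLam i) (u w : TLPath i m.1), m.1 < l.1 ∧
            y = st (dTLPath (Polynomial ℤ) Polynomial.X i u) *
              eStair (Polynomial ℤ) Polynomial.X i i m.1 *
              dTLPath (Polynomial ℤ) Polynomial.X i w}) ∧
    -- ... and the cellular star axiom holds.
    (∀ (l : TLLam i) (s t : TLPath i l.1),
      st (st (dTLPath (Polynomial ℤ) Polynomial.X i s) *
          eStair (Polynomial ℤ) Polynomial.X i i l.1 *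
          dTLPath (Polynomial ℤ) Polynomial.X i t)
        - (st (dTLPath (Polynomial ℤ) Polynomial.X i t) *
            eStair (Polynomial ℤ) Polynomial.X i i l.1 *
            dTLPath (Polynomial ℤ) Polynomial.X i s) ∈
        Submodule.span (Polynomial ℤ)
          {y | ∃ (m : TLLam i) (u w : TLPath i m.1), m.1 < l.1 ∧
            y = st (dTLPath (Polynomial ℤ) Polynomial.X i u) *
              eStair (Polynomial ℤ) Polynomial.X i i m.1 *
              dTLPath (Polynomial ℤ) Polynomial.X i w}) := by
  obtain ⟨K, _, _, q, q', hq, hδ, hinj⟩ := TemperleyLieb.exists_sum_inverse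
  refine ⟨⟨TemperleyLieb.cell_linearIndependent hq hδ hinj hst_mul hst_e,
    TemperleyLieb.cell_span hst_mul hst_st hst_e⟩, ⟨inferInstance, fun l => inferInstance⟩,
    fun l t a => TemperleyLieb.cell_mul hst_mul hst_st hst_e l t a, fun l s t => ?_⟩
  rw [TemperleyLieb.cell_star hst_mul hst_st hst_e]
  exact zero_mem _
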